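/- arXiv:1711.03182 — 17 statements merged into one kernel-verified Lean document; each statement's English description precedes it below -/
import Mathlib

section
/- For all nonnegative integers i and j, the identity ∑_{p=0}^{min(i,j)} (i+j-p)!/(p!·(i-p)!·(j-p)!) = ∑_{k=0}^{min(i,j)} 2^k·C(i,k)·C(j,k) holds. Equivalently, the infinite matrix A with entries A_{i,j} = ∑_{p=0}^{min(i,j)} (i+j-p)!/(p!(i-p)!(j-p)!) admits the LU decomposition A = LU where L is lower uni-triangular with L_{i,j} = C(i,j) and U is upper triangular with U_{i,j} = 2^i·C(j,i). -/
open Finset Nat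

theorem choose_mul_choose_sub_sub {j p m : ℕ} (hp : p ≤ j) (hm : m ≤ j) :
    j.choose p * (j - p).choose (j - m) = j.choose m * m.choose p := by
  rcases le_or_gt p m with h | h
  · rw [Nat.choose_mul h, ← Nat.choose_symm (show m - p ≤ j - p by omega)]
    congr 2
    omega
  · rw [Nat.choose_eq_zero_of_lt (show j - p < j - m by omega), Nat.choose_eq_zero_of_lt h]
    simp

theorem sum_range_choose_of_le {m j : ℕ} (h : m ≤ j) :
    ∑ p ∈ Finset.range (j + 1), m.choose p = 2 ^ m := by
  rw [← Nat.sum_range_choose m]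
  symm
  apply Finset.sum_subset
  · intro x hx
    simp only [Finset.mem_range] at *
    omega
  · intro x _ hx
    simp only [Finset.mem_range] at hx
    exact Nat.choose_eq_zero_of_lt (by omega)

theorem sum_choose_mul_choose_add_sub (i j : ℕ) :
    ∑ p ∈ Finset.range (j + 1), j.choose p * (i + j - p).choose j =
      ∑ k ∈ Finset.range (j + 1), 2 ^ k * i.choose k * j.choose k := by
  have key : ∀ p ∈ Finset.range (j + 1), j.choose p * (i + j - p).choose j =
      ∑ m ∈ Finset.range (j + 1), i.choose m * j.choose m * m.choose p := by
    intro p hp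
    have hp' : p ≤ j := Nat.lt_succ_iff.mp (Finset.mem_range.mp hp)
    rw [Nat.add_sub_assoc hp', Nat.add_choose_eq,
      Finset.Nat.sum_antidiagonal_eq_sum_range_succ_mk, Finset.mul_sum]
    refine Finset.sum_congr rfl fun m hm => ?_
    have hm' : m ≤ j := Nat.lt_succ_iff.mp (Finset.mem_range.mp hm)
    rw [mul_assoc, ← choose_mul_choose_sub_sub hp' hm']
    ring
  rw [Finset.sum_congr rfl key, Finset.sum_comm]
  refine Finset.sum_congr rfl fun m hm => ?_
  rw [← Finset.mul_sum, sum_range_choose_of_le (Nat.lt_succ_iff.mp (Finset.mem_range.mp hm))]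
  ring

theorem factorial_div_eq_choose_mul_choose {i j p : ℕ} (hi : p ≤ i) (hj : p ≤ j) :
    ((i + j - p)! : ℚ) / ((p ! : ℚ) * ((i - p)! : ℚ) * ((j - p)! : ℚ)) =
      ((j.choose p * (i + j - p).choose j : ℕ) : ℚ) := by
  rw [Nat.cast_mul, Nat.cast_choose ℚ hj, Nat.cast_choose ℚ (show j ≤ i + j - p by omega),
    show i + j - p - j = i - p by omega]
  have h1 := Nat.factorial_ne_zero p
  have h2 := Nat.factorial_ne_zero (i - p)
  have h3 := Nat.factorial_ne_zero (j - p)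
  have h4 := Nat.factorial_ne_zero j
  field_simp

/-- The Gessel–Viennot entry for large Schröder paths in the Aztec diamond,
`A i j = ∑_{p=0}^{min(i,j)} (i+j-p)!/(p!·(i-p)!·(j-p)!)`, equals the LU-product
`∑_{k=0}^{min(i,j)} 2^k·C(i,k)·C(j,k)` with `L i k = C(i,k)` and `U k j = 2^k·C(j,k)`. -/
theorem aztec_entry_LU (i j : ℕ) :
    ∑ p ∈ Finset.range (min i j + 1),
        ((i + j - p)! : ℚ) / ((p ! : ℚ) * ((i - p)! : ℚ) * ((j - p)! : ℚ)) =
      ∑ k ∈ Finset.range (min i j + 1),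
        (2 : ℚ) ^ k * (i.choose k : ℚ) * (j.choose k : ℚ) := by
  have hsub : Finset.range (min i j + 1) ⊆ Finset.range (j + 1) :=
    Finset.range_subset_range.mpr (by omega)
  have hl : ∑ p ∈ Finset.range (min i j + 1), j.choose p * (i + j - p).choose j =
      ∑ p ∈ Finset.range (j + 1), j.choose p * (i + j - p).choose j := by
    refine Finset.sum_subset hsub fun p hp hp' => ?_
    simp only [Finset.mem_range] at hp hp'
    rw [Nat.choose_eq_zero_of_lt (show i + j - p < j by omega), mul_zero]
  have hr : ∑ k ∈ Finset.range (min i j + 1), 2 ^ k * i.choose k * j.choose k =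
      ∑ k ∈ Finset.range (j + 1), 2 ^ k * i.choose k * j.choose k := by
    refine Finset.sum_subset hsub fun k hk hk' => ?_
    simp only [Finset.mem_range] at hk hk'
    rw [Nat.choose_eq_zero_of_lt (show i < k by omega), mul_zero, zero_mul]
  have h := (hl.trans (sum_choose_mul_choose_add_sub i j)).trans hr.symm
  rw [Finset.sum_congr rfl fun p hp => factorial_div_eq_choose_mul_choose
    (i := i) (j := j) (p := p) (by simp at hp; omega) (by simp at hp; omega)]
  exact_mod_cast h
end

section
/- For every nonnegative integer n, the determinant of the (n+1)×(n+1) matrix with (i,j) entry A_{i,j} = ∑_{p=0}^{min(i,j)} (i+j-p)!/(p!(i-p)!(j-p)!), for 0 ≤ i,j ≤ n, equals 2^{n(n+1)/2}. -/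
open Finset Nat

/-- Summing the number of ways to choose disjoint subsets of sizes `p` and `i - k` over `p`. -/
lemma sum_choose_mul_choose_sub {i k : ℕ} (hk : k ≤ i) :
    ∑ p ∈ range (i + 1), i.choose p * (i - p).choose (i - k) = i.choose k * 2 ^ k := by
  rw [← Nat.sum_range_choose, mul_sum]
  symm
  refine sum_subset_zero_on_sdiff (range_mono (by lia)) (fun p hp => ?_) (fun p hp => ?_)
  · simp only [mem_sdiff, mem_range] at hp
    rw [Nat.choose_eq_zero_of_lt (n := i - p) (by lia), mul_zero]
  · have hpk : p ≤ k := by simpa [Nat.lt_succ_iff] using hp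
    rw [Nat.choose_mul hpk, ← Nat.choose_symm (show k - p ≤ i - p by lia)]
    congr 2
    lia

/-- The two standard binomial expressions for the Delannoy number of `(i, j)` agree. -/
lemma sum_choose_mul_choose_add (i j : ℕ) :
    ∑ p ∈ range (i + 1), i.choose p * (i - p + j).choose i =
      ∑ k ∈ range (i + 1), i.choose k * 2 ^ k * j.choose k := by
  have vandermonde (p : ℕ) : (i - p + j).choose i =
      ∑ k ∈ range (i + 1), (i - p).choose (i - k) * j.choose k := by
    rw [add_comm, Nat.add_choose_eq, Finset.Nat.sum_antidiagonal_eq_sum_range_succ_mk]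
    exact sum_congr rfl fun k _ => mul_comm _ _
  simp_rw [vandermonde, mul_sum]
  rw [sum_comm]
  refine sum_congr rfl fun k hk => ?_
  rw [← sum_choose_mul_choose_sub (Nat.lt_succ_iff.mp (mem_range.mp hk)), sum_mul]
  exact sum_congr rfl fun p _ => (mul_assoc _ _ _).symm

/-- The multinomial expression for the Delannoy number of `(i, j)` in terms of binomials. -/
lemma sum_factorial_div_eq_sum_choose (i j : ℕ) :
    ∑ p ∈ range (min i j + 1), ((i + j - p)! : ℚ) / ((p ! : ℚ) * ((i - p)! : ℚ) * ((j - p)! : ℚ)) =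
      ∑ k ∈ range (i + 1), (i.choose k : ℚ) * 2 ^ k * j.choose k := by
  have key := congrArg (Nat.cast : ℕ → ℚ) (sum_choose_mul_choose_add i j)
  push_cast at key
  rw [← key]
  refine sum_subset_zero_on_sdiff (range_mono (by lia)) (fun p hp => ?_) (fun p hp => ?_)
  · simp only [mem_sdiff, mem_range] at hp
    rw [Nat.choose_eq_zero_of_lt (n := i - p + j) (by lia), Nat.cast_zero, mul_zero]
  · have hp' : p ≤ i ∧ p ≤ j := by
      rw [mem_range] at hp
      lia
    rw [Nat.cast_choose ℚ hp'.1, Nat.cast_choose ℚ (show i ≤ i - p + j by lia),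
      show i - p + j - i = j - p by lia, show i - p + j = i + j - p by lia]
    have := Nat.factorial_ne_zero i
    field_simp

/-- The lower triangular matrix of binomial coefficients has determinant one. -/
lemma det_choose (n : ℕ) :
    (Matrix.of fun i j : Fin n => ((i : ℕ).choose j : ℚ)).det = 1 := by
  rw [Matrix.det_of_isLowerTriangular]
  · simp
  · intro i j hij
    have hij' : (i : ℕ) < j := hij
    simp [Nat.choose_eq_zero_of_lt hij']

/-- The determinant of the (n+1)×(n+1) matrix with entries
`A i j = ∑_{p=0}^{min(i,j)} (i+j-p)!/(p!·(i-p)!·(j-p)!)` equals `2^{n(n+1)/2}`,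
the number of domino tilings of the Aztec diamond of size `n`. -/
theorem aztec_det (n : ℕ) :
    Matrix.det (Matrix.of fun i j : Fin (n + 1) =>
        ∑ p ∈ Finset.range (min (i : ℕ) (j : ℕ) + 1),
          (((i : ℕ) + (j : ℕ) - p)! : ℚ) /
            ((p ! : ℚ) * (((i : ℕ) - p)! : ℚ) * (((j : ℕ) - p)! : ℚ))) =
      2 ^ (n * (n + 1) / 2) := by
  have factorization : (Matrix.of fun i j : Fin (n + 1) =>
        ∑ p ∈ Finset.range (min (i : ℕ) (j : ℕ) + 1),
          (((i : ℕ) + (j : ℕ) - p)! : ℚ) /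
            ((p ! : ℚ) * (((i : ℕ) - p)! : ℚ) * (((j : ℕ) - p)! : ℚ))) =
      (Matrix.of fun i k : Fin (n + 1) => ((i : ℕ).choose k : ℚ)) *
        Matrix.diagonal (fun k : Fin (n + 1) => (2 : ℚ) ^ (k : ℕ)) *
        (Matrix.of fun j k : Fin (n + 1) => ((j : ℕ).choose k : ℚ)).transpose := by
    ext i j
    simp only [Matrix.of_apply, Matrix.mul_apply (M := _ * _), Matrix.mul_diagonal,
      Matrix.transpose_apply]
    rw [sum_factorial_div_eq_sum_choose,
      Fin.sum_univ_eq_sum_range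
        (fun k => ((i : ℕ).choose k : ℚ) * 2 ^ k * ((j : ℕ).choose k : ℚ))]
    refine sum_subset (range_mono (by lia)) fun k _ hk => ?_
    rw [Nat.choose_eq_zero_of_lt (by simpa using hk)]
    simp
  rw [factorization, Matrix.det_mul, Matrix.det_mul, Matrix.det_transpose, det_choose,
    Matrix.det_diagonal, one_mul, mul_one, prod_pow_eq_pow_sum,
    Fin.sum_univ_eq_sum_range (fun k => k), sum_range_id, Nat.add_sub_cancel, mul_comm n]
end

section
/- For all nonnegative integers n and ℓ with 0 ≤ ℓ ≤ n, one has ∑_{r=0}^{n} (-1)^{n+r}·C(n,r)·B_r = ∑_{p=0}^{ℓ} C(n,p), where B_r = ∑_{p=0}^{min(r+ℓ-n,\,n)} (r+ℓ-p)!/(p!·(r+ℓ-n-p)!·(n-p)!) when r+ℓ ≥ n, and B_r = 0 when r+ℓ < n. -/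
open Finset Nat

/-- The `n`-th forward difference of `x ↦ x.choose n` is constantly `1`. -/
theorem sum_alternating_choose_mul_choose_add (n k : ℕ) :
    ∑ r ∈ range (n + 1), (-1 : ℚ) ^ (n + r) * (n.choose r : ℚ) * ((k + r).choose n : ℚ) = 1 := by
  have h := congr_fun (fwdDiff_iter_choose 0 n) k
  rw [fwdDiff_iter_eq_sum_shift] at h
  simp only [add_zero, smul_eq_mul, mul_one, choose_zero_right, cast_one] at h
  have hq : ((∑ r ∈ range (n + 1), (-1 : ℤ) ^ (n - r) * (n.choose r : ℤ) *
      ((k + r).choose n : ℤ) : ℤ) : ℚ) = 1 := by exact_mod_cast h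
  refine Eq.trans ?_ hq
  push_cast
  refine sum_congr rfl fun r hr ↦ ?_
  have hrn : n + r = (n - r) + 2 * r := by have := mem_range.mp hr; lia
  rw [hrn, pow_add, pow_mul, neg_one_sq, one_pow, mul_one]

theorem factorial_div_eq_choose_mul_choose_s2 {m n p : ℕ} (hp : p ≤ n) (hm : n + p ≤ m) :
    ((m - p)! : ℚ) / ((p ! : ℚ) * ((m - n - p)! : ℚ) * ((n - p)! : ℚ)) =
      (n.choose p : ℚ) * ((m - p).choose n : ℚ) := by
  have hn : n ≤ m - p := by lia
  rw [cast_choose ℚ hp, cast_choose ℚ hn, Nat.sub_right_comm m p n]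
  field_simp

/-- The lattice path numbers `A_{r + ℓ - n, n}` as sums of products of binomial coefficients. -/
theorem aztec_path_count_eq_sum_choose {n ℓ r : ℕ} (hℓ : ℓ ≤ n) (hr : r ≤ n) :
    (if n ≤ r + ℓ then
        ∑ p ∈ range (min (r + ℓ - n) n + 1),
          ((r + ℓ - p)! : ℚ) / ((p ! : ℚ) * ((r + ℓ - n - p)! : ℚ) * ((n - p)! : ℚ))
      else 0) =
      ∑ p ∈ range (ℓ + 1), (n.choose p : ℚ) * ((ℓ - p + r).choose n : ℚ) := by
  split_ifs with h
  · rw [min_eq_left (by lia)]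
    have hsub : range (r + ℓ - n + 1) ⊆ range (ℓ + 1) := range_subset_range.mpr (by lia)
    rw [← sum_subset hsub]
    · refine sum_congr rfl fun p hp ↦ ?_
      have := mem_range.mp hp
      rw [factorial_div_eq_choose_mul_choose_s2 (by lia) (by lia),
        show ℓ - p + r = r + ℓ - p by lia]
    · intro p hp hp'
      rw [mem_range] at hp hp'
      rw [choose_eq_zero_of_lt (show ℓ - p + r < n by lia), cast_zero, mul_zero]
  · refine (sum_eq_zero fun p _ ↦ ?_).symm
    rw [choose_eq_zero_of_lt (show ℓ - p + r < n by lia), cast_zero, mul_zero]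

/-- The one-point function identity for the Aztec diamond: for `0 ≤ ℓ ≤ n`,
`∑_{r=0}^{n} (-1)^{n+r}·C(n,r)·B_r = ∑_{p=0}^{ℓ} C(n,p)`, where
`B_r = A_{r+ℓ-n, n} = ∑_{p=0}^{min(r+ℓ-n, n)} (r+ℓ-p)!/(p!·(r+ℓ-n-p)!·(n-p)!)`
if `r+ℓ ≥ n`, and `B_r = 0` otherwise. -/
theorem aztec_one_point (n ℓ : ℕ) (hℓ : ℓ ≤ n) :
    ∑ r ∈ Finset.range (n + 1), (-1 : ℚ) ^ (n + r) * (n.choose r : ℚ) *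
        (if n ≤ r + ℓ then
            ∑ p ∈ Finset.range (min (r + ℓ - n) n + 1),
              ((r + ℓ - p)! : ℚ) / ((p ! : ℚ) * ((r + ℓ - n - p)! : ℚ) * ((n - p)! : ℚ))
          else 0) =
      ∑ p ∈ Finset.range (ℓ + 1), (n.choose p : ℚ) := by
  calc
    _ = ∑ r ∈ range (n + 1), ∑ p ∈ range (ℓ + 1), (n.choose p : ℚ) *
          ((-1 : ℚ) ^ (n + r) * (n.choose r : ℚ) * ((ℓ - p + r).choose n : ℚ)) := by
      refine sum_congr rfl fun r hr ↦ ?_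
      rw [aztec_path_count_eq_sum_choose hℓ (by have := mem_range.mp hr; lia), mul_sum]
      exact sum_congr rfl fun p _ ↦ by ring
    _ = ∑ p ∈ range (ℓ + 1), (n.choose p : ℚ) := by
      rw [sum_comm]
      refine sum_congr rfl fun p _ ↦ ?_
      rw [← mul_sum, sum_alternating_choose_mul_choose_add, mul_one]
end

section
/- For all nonnegative integers n and k, the determinant of the (n+1)×(n+1) Hankel matrix with (i,j) entry c_{k+i+j}, for 0 ≤ i,j ≤ n, equals ∏_{i=0}^{n} (2i+1)!·(2k+2i)! / ((k+2i+1)!·(k+2i)!), where c_m = C(2m,m)/(m+1) is the m-th Catalan number. -/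
open Finset Nat

/-- The unnormalised lower triangular factor of the Hankel matrix of shifted Catalan numbers. -/
def catalanFactor (k i l : ℕ) : ℚ :=
  (i.choose l : ℚ) * (2 * (i + k))! / ((i + k)! * (i + k + l + 1)!)

/-- The diagonal factor of the Hankel matrix of shifted Catalan numbers. -/
def catalanWeight (k l : ℕ) : ℚ :=
  (2 * l + 1)! * ((l + k)! : ℚ) ^ 2 * (2 * l + k + 1) / (2 * (l + k))!

theorem catalanFactor_eq_zero (k : ℕ) {i l : ℕ} (h : i < l) : catalanFactor k i l = 0 := by
  simp [catalanFactor, Nat.choose_eq_zero_of_lt h]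

theorem cast_factorial_two_mul_succ (m : ℕ) :
    ((2 * (m + 1))! : ℚ) = (2 * m + 2) * (2 * m + 1) * (2 * m)! := by
  rw [show 2 * (m + 1) = 2 * m + 1 + 1 by ring, Nat.factorial_succ, Nat.factorial_succ]
  push_cast
  ring

theorem cast_choose_succ_mul (i l : ℕ) :
    (i.choose (l + 1) : ℚ) * (l + 1) = i.choose l * ((i : ℚ) - l) := by
  rcases le_or_gt l i with h | h
  · have := Nat.choose_succ_right_eq i l
    rw [← Nat.cast_sub h]
    exact_mod_cast this
  · simp [Nat.choose_eq_zero_of_lt h, Nat.choose_eq_zero_of_lt (h.trans (Nat.lt_succ_self l))]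

theorem catalanFactor_succ_zero (k i : ℕ) :
    catalanFactor k (i + 1) 0 = 2 * (2 * k + 1) / (k + 2) * catalanFactor k i 0 +
      6 / (k + 2) * catalanFactor k i 1 := by
  have h1 : i + 1 + k = i + k + 1 := by ring
  simp only [catalanFactor, h1, cast_factorial_two_mul_succ, add_zero, Nat.factorial_succ,
    Nat.choose_zero_right, Nat.choose_one_right]
  have := Nat.cast_ne_zero (R := ℚ).2 (i + k).factorial_ne_zero
  push_cast
  field_simp
  ring

theorem catalanFactor_succ_succ (k l : ℕ) : ∃ β : ℚ, ∀ i,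
    catalanFactor k (i + 1) (l + 1) =
      2 * (2 * k + 2 * l + 1) / ((2 * l + k + 2) * (2 * l + k + 3)) * catalanFactor k i l +
      β * catalanFactor k i (l + 1) +
      2 * (l + k + 2) * (2 * l + 5) * (l + 2) / ((2 * l + k + 4) * (2 * l + k + 3)) *
        catalanFactor k i (l + 2) := by
  refine ⟨(2 * (l + 2) * (2 * k + 2 * l + 3) -
    2 * (l + 1) * (2 * k + 2 * l + 1) * (2 * l + k + 4) / (2 * l + k + 2)) / (2 * l + k + 4),
    fun i => ?_⟩
  have h1 : i + 1 + k = i + k + 1 := by ring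
  have e1 : (i.choose (l + 1) : ℚ) = i.choose l * ((i : ℚ) - l) / (l + 1) := by
    rw [← cast_choose_succ_mul]; field_simp
  have e2 : (i.choose (l + 2) : ℚ) = i.choose (l + 1) * ((i : ℚ) - (l + 1)) / (l + 2) := by
    have := cast_choose_succ_mul i (l + 1)
    push_cast at this
    rw [← this]; field_simp; ring
  have f1 : i + k + 1 + (l + 1) + 1 = i + k + l + 1 + 1 + 1 := by ring
  have f2 : i + k + (l + 1) + 1 = i + k + l + 1 + 1 := by ring
  have f3 : i + k + (l + 2) + 1 = i + k + l + 1 + 1 + 1 := by ring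
  simp only [catalanFactor, h1, f1, f2, f3, cast_factorial_two_mul_succ, Nat.choose_succ_succ' i l,
    Nat.cast_add, e2, e1, Nat.factorial_succ (i + k), Nat.factorial_succ (i + k + l + 1),
    Nat.factorial_succ (i + k + l + 1 + 1)]
  have := Nat.cast_ne_zero (R := ℚ).2 (i + k).factorial_ne_zero
  have := Nat.cast_ne_zero (R := ℚ).2 (i + k + l + 1).factorial_ne_zero
  push_cast
  field_simp
  ring

theorem catalanWeight_succ (k l : ℕ) :
    catalanWeight k (l + 1) * (2 * (2 * k + 2 * l + 1) / ((2 * l + k + 2) * (2 * l + k + 3))) =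
      catalanWeight k l *
        (2 * (l + k + 1) * (2 * l + 3) * (l + 1) / ((2 * l + k + 2) * (2 * l + k + 1))) := by
  have h1 : l + 1 + k = l + k + 1 := by ring
  have h2 : 2 * (l + 1) + 1 = 2 * l + 1 + 1 + 1 := by ring
  simp only [catalanWeight, h1, h2, cast_factorial_two_mul_succ, Nat.factorial_succ (l + k),
    Nat.factorial_succ (2 * l + 1 + 1), Nat.factorial_succ (2 * l + 1)]
  have := Nat.cast_ne_zero (R := ℚ).2 (2 * (l + k)).factorial_ne_zero
  push_cast
  field_simp
  ring

/-- Telescoping form of the symmetry of multiplication by the variable. -/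
theorem sum_catalanFactor_sub (k i j N : ℕ) :
    ∑ l ∈ range (N + 1), catalanWeight k l *
      (catalanFactor k (i + 1) l * catalanFactor k j l -
        catalanFactor k i l * catalanFactor k (j + 1) l) =
      catalanWeight k (N + 1) *
        (2 * (2 * k + 2 * N + 1) / ((2 * N + k + 2) * (2 * N + k + 3))) *
        (catalanFactor k i (N + 1) * catalanFactor k j N -
          catalanFactor k i N * catalanFactor k j (N + 1)) := by
  induction N with
  | zero =>
    rw [catalanWeight_succ]
    simp only [zero_add, sum_range_one, catalanFactor_succ_zero]
    push_cast
    field_simp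
    ring
  | succ N ih =>
    obtain ⟨β, hβ⟩ := catalanFactor_succ_succ k N
    rw [sum_range_succ, ih, catalanWeight_succ k (N + 1), hβ i, hβ j]
    push_cast
    field_simp
    ring

theorem sum_catalanFactor (k N : ℕ) {j : ℕ} (hj : j ≤ N) (i : ℕ) :
    ∑ l ∈ range (N + 1), catalanFactor k i l * catalanWeight k l * catalanFactor k j l =
      ((2 * (k + i + j)).choose (k + i + j) : ℚ) / ((k : ℚ) + i + j + 1) := by
  induction j generalizing i with
  | zero =>
    rw [sum_eq_single_of_mem 0 (by simp)
      fun l _ hl => by rw [catalanFactor_eq_zero k (Nat.pos_of_ne_zero hl), mul_zero]]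
    have hc : ((2 * (i + k)).choose (i + k) : ℚ) =
        (2 * (i + k))! / ((i + k)! * (i + k)!) := by
      rw [Nat.cast_choose ℚ (by lia), show 2 * (i + k) - (i + k) = i + k by lia]
    have := Nat.cast_ne_zero (R := ℚ).2 (i + k).factorial_ne_zero
    have := Nat.cast_ne_zero (R := ℚ).2 k.factorial_ne_zero
    have := Nat.cast_ne_zero (R := ℚ).2 (2 * k).factorial_ne_zero
    rw [add_zero, add_comm k i, hc]
    simp only [catalanFactor, catalanWeight, Nat.factorial_succ, add_zero, zero_add, mul_zero,
      Nat.choose_zero_right]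
    push_cast
    field_simp
    simp only [Nat.factorial_zero, Nat.cast_one, mul_zero, zero_add, one_mul, add_zero]
    ring
  | succ j ih =>
    have h := sum_catalanFactor_sub k i j N
    rw [catalanFactor_eq_zero k (show j < N by lia),
      catalanFactor_eq_zero k (show j < N + 1 by lia), mul_zero, mul_zero, sub_zero, mul_zero] at h
    have h' := ih (by lia) (i + 1)
    rw [show k + i + (j + 1) = k + (i + 1) + j by ring]
    push_cast at h' ⊢
    rw [show (k : ℚ) + i + (j + 1) + 1 = k + (i + 1) + j + 1 by ring, ← h', ← sub_eq_zero,
      ← neg_eq_zero, ← h, ← sum_sub_distrib, ← sum_neg_distrib]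
    exact sum_congr rfl fun l _ => by ring

/-- The Hankel determinant of Catalan numbers `c_{k+i+j}`, where
`c_m = C(2m,m)/(m+1)`, equals
`∏_{i=0}^{n} (2i+1)!·(2k+2i)!/((k+2i+1)!·(k+2i)!)`. -/
theorem catalan_hankel_det (n k : ℕ) :
    Matrix.det (Matrix.of fun i j : Fin (n + 1) =>
        (((2 * (k + (i : ℕ) + (j : ℕ))).choose (k + (i : ℕ) + (j : ℕ)) : ℚ)) /
          ((k : ℚ) + (i : ℕ) + (j : ℕ) + 1)) =
      ∏ i ∈ Finset.range (n + 1),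
        ((2 * i + 1)! : ℚ) * ((2 * k + 2 * i)! : ℚ) /
          (((k + 2 * i + 1)! : ℚ) * ((k + 2 * i)! : ℚ)) := by
  let A : Matrix (Fin (n + 1)) (Fin (n + 1)) ℚ := Matrix.of fun i l => catalanFactor k i l
  have hA : A.det = ∏ i : Fin (n + 1), catalanFactor k i i :=
    Matrix.det_of_isLowerTriangular A fun i j hij => catalanFactor_eq_zero k (by simpa using hij)
  have hM : (Matrix.of fun i j : Fin (n + 1) =>
        (((2 * (k + (i : ℕ) + (j : ℕ))).choose (k + (i : ℕ) + (j : ℕ)) : ℚ)) /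
          ((k : ℚ) + (i : ℕ) + (j : ℕ) + 1)) =
      A * Matrix.diagonal (fun l : Fin (n + 1) => catalanWeight k l) * A.transpose := by
    ext i j
    rw [Matrix.mul_apply, Matrix.of_apply, ← sum_catalanFactor k n (Nat.lt_succ_iff.1 j.2) i,
      ← Fin.sum_univ_eq_sum_range
        (fun l => catalanFactor k i l * catalanWeight k l * catalanFactor k j l)]
    simp [A, Matrix.mul_diagonal]
  rw [hM, Matrix.det_mul, Matrix.det_mul, Matrix.det_transpose, Matrix.det_diagonal, hA,
    ← prod_mul_distrib, ← prod_mul_distrib, ← Fin.prod_univ_eq_prod_range]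
  refine prod_congr rfl fun i _ => ?_
  generalize (i : ℕ) = l
  have e1 : l + k + l + 1 = k + 2 * l + 1 := by ring
  have e2 : 2 * k + 2 * l = 2 * (l + k) := by ring
  simp only [catalanFactor, catalanWeight, Nat.choose_self, e1, e2, Nat.factorial_succ (k + 2 * l)]
  have := Nat.cast_ne_zero (R := ℚ).2 (l + k).factorial_ne_zero
  have := Nat.cast_ne_zero (R := ℚ).2 (k + 2 * l).factorial_ne_zero
  have := Nat.cast_ne_zero (R := ℚ).2 (2 * (l + k)).factorial_ne_zero
  push_cast
  field_simp
  ring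
end

section
/- For all nonnegative integers k, i, j with i ≥ j, define f_{k,i,j} = ∑_{r=0}^{i} (-1)^{r+i}·C(k+r+i, i-j)·C(k+i+j+1, i-r)·C(k+r, r)·C(2k+2r+2j, 2j). Then f_{k,i,i} = (2i+1)·C(k+i, k), and f_{k,i,j} = 0 whenever i > j. -/
open Finset Nat

/-- The `n`-th alternating binomial sum of a polynomial of degree less than `n` vanishes. -/
theorem sum_neg_one_pow_mul_choose_mul_eval (P : Polynomial ℚ) (n : ℕ) (hP : P.degree < n) :
    ∑ r ∈ range (n + 1), (-1 : ℚ) ^ (r + n) * (n.choose r : ℚ) * P.eval (r : ℚ) = 0 := by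
  rcases eq_or_ne P 0 with rfl | hP0
  · simp
  have h := congrFun (Polynomial.fwdDiff_iter_eq_zero_of_degree_lt
    ((Polynomial.natDegree_lt_iff_degree_lt hP0).2 hP)) 0
  rw [fwdDiff_iter_eq_sum_shift] at h
  rw [← Pi.zero_apply (M := fun _ : ℚ => ℚ) 0, ← h]
  refine sum_congr rfl fun r hr => ?_
  have hr' : r ≤ n := Nat.lt_succ_iff.1 (mem_range.1 hr)
  obtain ⟨d, rfl⟩ := Nat.exists_eq_add_of_le hr'
  have : (-1 : ℚ) ^ (r + (r + d)) = (-1) ^ d := by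
    rw [← add_assoc, pow_add, ← two_mul, pow_mul]; simp
  simp [this]

theorem fwdDiff_iter_inv (n : ℕ) (y : ℚ) (hy : 0 < y) :
    (fwdDiff 1)^[n] (fun x : ℚ => x⁻¹) y = (-1) ^ n * n ! / ∏ m ∈ range (n + 1), (y + m) := by
  induction n generalizing y with
  | zero => simp
  | succ n ih =>
    have h1 : ∏ m ∈ range (n + 1), (y + 1 + m) = ∏ m ∈ range (n + 1), (y + (m + 1 : ℕ)) :=
      prod_congr rfl fun m _ => by push_cast; ring
    rw [Function.iterate_succ_apply', fwdDiff, ih y hy, ih (y + 1) (by linarith), h1,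
      prod_range_succ' _ (n + 1), prod_range_succ _ n, prod_range_succ' _ n,
      Nat.factorial_succ]
    have h2 : ∏ m ∈ range n, (y + (m + 1 : ℕ)) ≠ 0 :=
      (prod_pos fun m _ => by positivity).ne'
    have h3 : y + (n + 1 : ℕ) ≠ 0 := by positivity
    have h4 : y ≠ 0 := hy.ne'
    push_cast at *
    field_simp
    ring

theorem sum_neg_one_pow_mul_choose_div (n : ℕ) (y : ℚ) (hy : 0 < y) :
    ∑ r ∈ range (n + 1), (-1 : ℚ) ^ (r + n) * (n.choose r : ℚ) * (y + r)⁻¹ =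
      (-1) ^ n * n ! / ∏ m ∈ range (n + 1), (y + m) := by
  rw [← fwdDiff_iter_inv n y hy, fwdDiff_iter_eq_sum_shift]
  refine sum_congr rfl fun r hr => ?_
  have hr' : r ≤ n := Nat.lt_succ_iff.1 (mem_range.1 hr)
  obtain ⟨d, rfl⟩ := Nat.exists_eq_add_of_le hr'
  have : (-1 : ℚ) ^ (r + (r + d)) = (-1) ^ d := by
    rw [← add_assoc, pow_add, ← two_mul, pow_mul]; simp
  simp [this]

/-- The alternating binomial sum of `P(r) / (y + r)` with `deg P ≤ n` only sees `P(-y)`. -/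
theorem sum_neg_one_pow_mul_choose_mul_eval_div (P : Polynomial ℚ) (n : ℕ) (hP : P.degree ≤ n)
    (y : ℚ) (hy : 0 < y) :
    ∑ r ∈ range (n + 1), (-1 : ℚ) ^ (r + n) * (n.choose r : ℚ) * (P.eval (r : ℚ) * (y + r)⁻¹) =
      P.eval (-y) * ((-1) ^ n * n ! / ∏ m ∈ range (n + 1), (y + m)) := by
  rcases eq_or_ne P 0 with rfl | hP0
  · simp
  have hdeg : (P /ₘ (Polynomial.X - Polynomial.C (-y))).degree < n :=
    (Polynomial.degree_divByMonic_lt _ _ hP0 (by simp)).trans_le hP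
  have hdiv := Polynomial.modByMonic_add_div P (Polynomial.X - Polynomial.C (-y))
  rw [Polynomial.modByMonic_X_sub_C_eq_C_eval] at hdiv
  rw [← sum_neg_one_pow_mul_choose_div n y hy, mul_sum,
    ← add_zero (∑ r ∈ range (n + 1), P.eval (-y) * _),
    ← sum_neg_one_pow_mul_choose_mul_eval _ n hdeg, ← sum_add_distrib]
  refine sum_congr rfl fun r _ => ?_
  have he := congrArg (Polynomial.eval (r : ℚ)) hdiv
  simp only [Polynomial.eval_add, Polynomial.eval_mul, Polynomial.eval_sub, Polynomial.eval_X,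
    Polynomial.eval_C] at he
  have : y + r ≠ 0 := by positivity
  rw [← he]
  field_simp
  ring

theorem factorial_two_mul_add (n j : ℕ) :
    (2 * n + 2 * j)! * n ! =
      (2 * n)! * (n + j)! * 2 ^ j * ∏ m ∈ range j, (2 * n + 2 * m + 1) := by
  induction j with
  | zero => simp
  | succ j ih =>
    rw [show 2 * n + 2 * (j + 1) = 2 * n + 2 * j + 1 + 1 by ring, Nat.factorial_succ,
      Nat.factorial_succ, prod_range_succ, ← add_assoc n j 1, Nat.factorial_succ (n + j)]
    linear_combination (2 * n + 2 * j + 1 + 1) * (2 * n + 2 * j + 1) * ih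

/-- Separating the factors of the summand that do not depend on `r`. -/
theorem choose_mul_choose_mul_choose_mul_choose (k i j r : ℕ) (h : j ≤ i) (hr : r ≤ i) :
    (((k + r + i).choose (i - j) : ℚ) * ((k + i + j + 1).choose (i - r) : ℚ) *
        ((k + r).choose r : ℚ) * ((2 * k + 2 * r + 2 * j).choose (2 * j) : ℚ)) *
        ((i - j)! * k ! * (2 * j)! * i !) =
      ((k + i + j + 1)! * 2 ^ j) * (i.choose r *
        (((k + r + i)! / (k + r + j + 1)! : ℚ) *
          ∏ m ∈ range j, (2 * (k + r) + 2 * m + 1 : ℚ))) := by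
  have e1 : ((k + r + i).choose (i - j) : ℚ) = (k + r + i)! / ((i - j)! * (k + r + j)!) := by
    rw [Nat.cast_choose ℚ (by omega), show k + r + i - (i - j) = k + r + j by omega]
  have e2 : ((k + i + j + 1).choose (i - r) : ℚ) =
      (k + i + j + 1)! / ((i - r)! * (k + r + j + 1)!) := by
    rw [Nat.cast_choose ℚ (by omega), show k + i + j + 1 - (i - r) = k + r + j + 1 by omega]
  have e3 : ((k + r).choose r : ℚ) = (k + r)! / (r ! * k !) := by
    rw [Nat.cast_choose ℚ (by omega), show k + r - r = k by omega]
  have e4 : ((2 * k + 2 * r + 2 * j).choose (2 * j) : ℚ) =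
      (2 * (k + r) + 2 * j)! / ((2 * j)! * (2 * (k + r))!) := by
    rw [Nat.cast_choose ℚ (by omega), ← mul_add,
      show 2 * (k + r) + 2 * j - 2 * j = 2 * (k + r) by omega]
  have e5 : (i.choose r : ℚ) = i ! / (r ! * (i - r)!) := Nat.cast_choose ℚ hr
  have e6 : ((2 * (k + r) + 2 * j)! : ℚ) = (2 * (k + r))! * (k + r + j)! * 2 ^ j *
      (∏ m ∈ range j, (2 * (k + r) + 2 * m + 1 : ℚ)) / (k + r)! := by
    rw [eq_div_iff (by positivity)]
    exact_mod_cast factorial_two_mul_add (k + r) j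
  rw [e1, e2, e3, e4, e5, e6]
  field_simp

theorem degree_prod_linear_le (n : ℕ) (a : ℚ) (f : ℕ → ℚ) :
    (∏ m ∈ range n, (Polynomial.C a * Polynomial.X + Polynomial.C (f m)) : Polynomial ℚ).degree ≤ (n : WithBot ℕ) := by
  refine (Polynomial.degree_prod_le _ _).trans
    ((sum_le_sum fun m _ => Polynomial.degree_linear_le).trans ?_)
  simp

theorem prod_odd_mul_factorial (n : ℕ) :
    (∏ m ∈ range n, (2 * (m : ℚ) + 3)) * (2 ^ n * n !) = (2 * n + 1)! := by
  induction n with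
  | zero => simp
  | succ n ih =>
    rw [prod_range_succ, show 2 * (n + 1) + 1 = 2 * n + 1 + 1 + 1 by ring,
      Nat.factorial_succ (2 * n + 1 + 1), Nat.factorial_succ (2 * n + 1), Nat.factorial_succ n]
    push_cast
    rw [← ih]
    ring

theorem factorial_mul_prod (a n : ℕ) :
    (a ! : ℚ) * ∏ m ∈ range n, ((a : ℚ) + 1 + m) = (a + n)! := by
  rw [← Nat.factorial_mul_ascFactorial, Nat.ascFactorial_eq_prod_range]
  push_cast
  rfl

theorem triangularity_sum_of_lt (k i j : ℕ) (h : j < i) :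
    ∑ r ∈ range (i + 1), (-1 : ℚ) ^ (r + i) * (i.choose r : ℚ) *
      (((k + r + i)! / (k + r + j + 1)! : ℚ) *
        ∏ m ∈ range j, (2 * (k + r) + 2 * m + 1 : ℚ)) = 0 := by
  obtain ⟨d, rfl⟩ := Nat.exists_eq_add_of_lt h
  let P : Polynomial ℚ :=
    (∏ m ∈ range d, (Polynomial.C 1 * Polynomial.X + Polynomial.C (k + j + 2 + m : ℚ))) *
      ∏ m ∈ range j, (Polynomial.C 2 * Polynomial.X + Polynomial.C (2 * k + 2 * m + 1 : ℚ))
  have hP : P.degree < (j + d + 1 : ℕ) := by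
    refine (Polynomial.degree_mul_le _ _).trans_lt ((add_le_add (degree_prod_linear_le d _ _)
      (degree_prod_linear_le j _ _)).trans_lt ?_)
    norm_cast
    omega
  rw [← sum_neg_one_pow_mul_choose_mul_eval P _ hP]
  refine sum_congr rfl fun r _ => ?_
  congr 1
  have e := factorial_mul_prod (k + r + j + 1) d
  rw [show k + r + (j + d + 1) = k + r + j + 1 + d by ring, ← e,
    mul_div_cancel_left₀ _ (by positivity)]
  simp only [P, Polynomial.eval_mul, Polynomial.eval_prod, Polynomial.eval_add,
    Polynomial.eval_C, Polynomial.eval_X]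
  congr 1 <;> refine prod_congr rfl fun m _ => ?_ <;> push_cast <;> ring

theorem triangularity_sum_diag (k i : ℕ) :
    ∑ r ∈ range (i + 1), (-1 : ℚ) ^ (r + i) * (i.choose r : ℚ) *
      (((k + r + i)! / (k + r + i + 1)! : ℚ) *
        ∏ m ∈ range i, (2 * (k + r) + 2 * m + 1 : ℚ)) =
      (∏ m ∈ range i, (2 * (m : ℚ) + 3)) * i ! * (k + i)! / (k + 2 * i + 1)! := by
  let P : Polynomial ℚ :=
    ∏ m ∈ range i, (Polynomial.C 2 * Polynomial.X + Polynomial.C (2 * k + 2 * m + 1 : ℚ))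
  have hsum := sum_neg_one_pow_mul_choose_mul_eval_div P i (degree_prod_linear_le i _ _)
    (k + i + 1) (by positivity)
  have hP : P.eval (-(k + i + 1 : ℚ)) = (-1) ^ i * ∏ m ∈ range i, (2 * (m : ℚ) + 3) := by
    rw [← prod_range_reflect (fun m => 2 * (m : ℚ) + 3), ← card_range i, ← prod_const,
      card_range, ← prod_mul_distrib, Polynomial.eval_prod]
    refine prod_congr rfl fun m hm => ?_
    obtain ⟨d, rfl⟩ := Nat.exists_eq_add_of_lt (mem_range.1 hm)
    rw [show m + d + 1 - 1 - m = d by omega]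
    simp only [Polynomial.eval_add, Polynomial.eval_mul, Polynomial.eval_C, Polynomial.eval_X]
    push_cast
    ring
  have hfac := factorial_mul_prod (k + i) (i + 1)
  rw [show k + i + (i + 1) = k + 2 * i + 1 by ring, Nat.cast_add] at hfac
  have hprod : ∏ m ∈ range (i + 1), ((k : ℚ) + i + 1 + m) ≠ 0 :=
    (prod_pos fun m _ => by positivity).ne'
  have hsq : ((-1 : ℚ) ^ i) * (-1) ^ i = 1 := by rw [← mul_pow]; simp
  trans P.eval (-(k + i + 1 : ℚ)) * ((-1) ^ i * i ! / ∏ m ∈ range (i + 1), ((k : ℚ) + i + 1 + m))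
  · rw [← hsum]
    refine sum_congr rfl fun r _ => ?_
    congr 1
    rw [mul_comm, Nat.factorial_succ]
    congr 1
    · simp only [P, Polynomial.eval_prod, Polynomial.eval_add, Polynomial.eval_mul,
        Polynomial.eval_C, Polynomial.eval_X]
      exact prod_congr rfl fun m _ => by ring
    · have : (k : ℚ) + i + 1 + r ≠ 0 := by positivity
      push_cast
      field_simp
      ring
  · rw [hP, ← hfac]
    field_simp
    linear_combination hsq

/-- For `i ≥ j`, the alternating sum
`f_{k,i,j} = ∑_{r=0}^{i} (-1)^{r+i}·C(k+r+i, i-j)·C(k+i+j+1, i-r)·C(k+r, r)·C(2k+2r+2j, 2j)`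
equals `(2i+1)·C(k+i,k)` when `i = j`, and `0` when `i > j`. -/
theorem triangularity_sum (k i j : ℕ) (h : j ≤ i) :
    ∑ r ∈ Finset.range (i + 1),
        (-1 : ℤ) ^ (r + i) * ((k + r + i).choose (i - j) : ℤ) *
          ((k + i + j + 1).choose (i - r) : ℤ) * ((k + r).choose r : ℤ) *
          ((2 * k + 2 * r + 2 * j).choose (2 * j) : ℤ) =
      if i = j then (2 * i + 1 : ℤ) * ((k + i).choose k : ℤ) else 0 := by
  rw [← Int.cast_inj (α := ℚ)]
  have hc : ((i - j)! * k ! * (2 * j)! * i ! : ℚ) ≠ 0 := by positivity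
  apply mul_right_cancel₀ hc
  trans ((k + i + j + 1)! * 2 ^ j : ℚ) * ∑ r ∈ range (i + 1), (-1 : ℚ) ^ (r + i) *
      (i.choose r : ℚ) * (((k + r + i)! / (k + r + j + 1)! : ℚ) *
        ∏ m ∈ range j, (2 * (k + r) + 2 * m + 1 : ℚ))
  · push_cast
    rw [sum_mul, mul_sum]
    refine sum_congr rfl fun r hr => ?_
    linear_combination (-1 : ℚ) ^ (r + i) * choose_mul_choose_mul_choose_mul_choose k i j r h
      (Nat.lt_succ_iff.1 (mem_range.1 hr))
  · split_ifs with hij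
    · subst hij
      rw [triangularity_sum_diag, show k + i + i + 1 = k + 2 * i + 1 by ring]
      push_cast
      have hodd := prod_odd_mul_factorial i
      rw [Nat.factorial_succ] at hodd
      push_cast at hodd
      rw [Nat.cast_choose ℚ (by omega : k ≤ k + i), Nat.add_sub_cancel_left, Nat.sub_self]
      field_simp
      simp only [Nat.factorial_zero, Nat.cast_one]
      linear_combination hodd
    · rw [triangularity_sum_of_lt k i j (by omega)]
      simp
end

section
/- Let n, k, ℓ be nonnegative integers with 0 ≤ ℓ ≤ n+k. Then the following identity of rational numbers holds: (n+ℓ+1)·(k+2n+1)!·n!/((2n+1)!·(n+k)!) · ∑_{r=0}^{n} (-1)^{n+r}·T_r = (1/C(2n+2k, n+ℓ)) · ∑_{s=0}^{n} C(n+ℓ+1, 2n+1-2s)·C(2n+k-s, n+ℓ), where T_r = (k+r)!·(n+k+r)!·(2k+2r+n-ℓ)! / ((2k+2r)!·r!·(n-r)!·(n+k+r+1)!·(k+r-ℓ)!) when k+r ≥ ℓ, and T_r = 0 when k+r < ℓ. -/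
open Finset Nat

/-- The summand of the balanced `₃F₂` obtained by differencing the one-point function in `ℓ`,
without its binomial factor. -/
def diffSummand (n m ℓ : ℕ) : ℚ :=
  if ℓ ≤ m then (m ! : ℚ) * ((2 * m + n - ℓ - 1)! : ℚ) / (((2 * m)! : ℚ) * ((m - ℓ)! : ℚ)) else 0

/-- The summand `T_r` of the one-point function, with `m = k + r` and without the factor
`1 / (r! (n - r)!)`. -/
def onePointSummand (n m ℓ : ℕ) : ℚ :=
  if ℓ ≤ m then (m ! : ℚ) * ((n + m)! : ℚ) * ((2 * m + n - ℓ)! : ℚ) /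
    (((2 * m)! : ℚ) * ((n + m + 1)! : ℚ) * ((m - ℓ)! : ℚ)) else 0

lemma diffSummand_succ_right (n m ℓ : ℕ) :
    (2 * (m : ℚ) + n - ℓ - 1) * diffSummand n m (ℓ + 1) = (m - ℓ) * diffSummand n m ℓ := by
  unfold diffSummand
  rcases lt_trichotomy m ℓ with h | rfl | h
  · rw [if_neg (by omega), if_neg (by omega)]; simp
  · rw [if_neg (by omega)]; simp
  · obtain ⟨t, rfl⟩ := Nat.exists_eq_add_of_lt h
    rw [if_pos (by omega), if_pos (by omega)]
    rw [show 2 * (ℓ + t + 1) + n - (ℓ + 1) - 1 = ℓ + 2 * t + n by omega,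
      show 2 * (ℓ + t + 1) + n - ℓ - 1 = ℓ + 2 * t + n + 1 by omega,
      show ℓ + t + 1 - (ℓ + 1) = t by omega, show ℓ + t + 1 - ℓ = t + 1 by omega,
      Nat.factorial_succ (ℓ + 2 * t + n), Nat.factorial_succ t]
    have := Nat.factorial_ne_zero (2 * (ℓ + t + 1))
    have := Nat.factorial_ne_zero t
    push_cast
    field_simp
    ring

lemma diffSummand_succ_succ (n m ℓ : ℕ) (h : 0 < n + m) :
    2 * (2 * (m : ℚ) + 1) * diffSummand n (m + 1) (ℓ + 1) =
      (2 * m + n - ℓ) * diffSummand n m ℓ := by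
  unfold diffSummand
  by_cases hm : ℓ ≤ m
  · obtain ⟨t, rfl⟩ := Nat.exists_eq_add_of_le hm
    obtain ⟨u, hu⟩ : ∃ u, 2 * (ℓ + t) + n - ℓ = u + 1 := ⟨2 * (ℓ + t) + n - ℓ - 1, by omega⟩
    have hu' : (u : ℚ) + 1 = 2 * (ℓ + t) + n - ℓ := by
      have : u + 1 + ℓ = 2 * (ℓ + t) + n := by omega
      have : (u : ℚ) + 1 + ℓ = 2 * (ℓ + t) + n := by exact_mod_cast this
      linarith
    rw [if_pos (by omega), if_pos (by omega),
      show 2 * (ℓ + t + 1) + n - (ℓ + 1) - 1 = u + 1 by omega,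
      show 2 * (ℓ + t) + n - ℓ - 1 = u by omega,
      show ℓ + t + 1 - (ℓ + 1) = t by omega, show ℓ + t - ℓ = t by omega,
      show 2 * (ℓ + t + 1) = 2 * (ℓ + t) + 1 + 1 by ring,
      Nat.factorial_succ (2 * (ℓ + t) + 1), Nat.factorial_succ (2 * (ℓ + t)),
      Nat.factorial_succ u, Nat.factorial_succ (ℓ + t)]
    have := Nat.factorial_ne_zero (2 * (ℓ + t))
    have := Nat.factorial_ne_zero t
    push_cast
    rw [hu']
    field_simp
    ring
  · rw [if_neg (by omega), if_neg hm]; simp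

lemma onePointSummand_eq (n m ℓ : ℕ) (h : 0 < n + m) :
    ((n : ℚ) + m + 1) * onePointSummand n m ℓ = (2 * m + n - ℓ) * diffSummand n m ℓ := by
  unfold diffSummand onePointSummand
  by_cases hm : ℓ ≤ m
  · obtain ⟨t, rfl⟩ := Nat.exists_eq_add_of_le hm
    obtain ⟨u, hu⟩ : ∃ u, 2 * (ℓ + t) + n - ℓ = u + 1 := ⟨2 * (ℓ + t) + n - ℓ - 1, by omega⟩
    have hu' : 2 * ((ℓ : ℚ) + t) + n - ℓ = u + 1 := by
      have : u + 1 + ℓ = 2 * (ℓ + t) + n := by omega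
      have : (u : ℚ) + 1 + ℓ = 2 * (ℓ + t) + n := by exact_mod_cast this
      linarith
    rw [if_pos hm, if_pos hm, hu, Nat.add_sub_cancel, Nat.factorial_succ u,
      Nat.factorial_succ (n + (ℓ + t))]
    have := Nat.factorial_ne_zero (2 * (ℓ + t))
    have := Nat.factorial_ne_zero (n + (ℓ + t))
    have := Nat.factorial_ne_zero (ℓ + t - ℓ)
    push_cast
    rw [hu']
    field_simp
  · rw [if_neg hm, if_neg hm]; simp

lemma onePointSummand_sub (n m ℓ : ℕ) (h : 0 < n + m) :
    ((n : ℚ) + ℓ + 1) * onePointSummand n m ℓ -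
      ((n : ℚ) + ℓ + 2) * onePointSummand n m (ℓ + 1) = (n + ℓ) * diffSummand n m ℓ := by
  have h1 := onePointSummand_eq n m ℓ h
  have h2 := onePointSummand_eq n m (ℓ + 1) h
  have h3 := diffSummand_succ_right n m ℓ
  have h0 : (n : ℚ) + m + 1 ≠ 0 := by positivity
  apply mul_left_cancel₀ h0
  push_cast at h2
  linear_combination ((n : ℚ) + ℓ + 1) * h1 - ((n : ℚ) + ℓ + 2) * h2 - ((n : ℚ) + ℓ + 2) * h3

/-- The alternating binomial sum of `onePointSummand`, including the factor `n + ℓ + 1`. -/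
def onePointSum (n k ℓ : ℕ) : ℚ :=
  ((n : ℚ) + ℓ + 1) *
    ∑ r ∈ range (n + 1), (-1) ^ (n + r) * (n.choose r : ℚ) * onePointSummand n (k + r) ℓ

/-- The alternating binomial sum of `diffSummand`. -/
def diffSum (n k ℓ : ℕ) : ℚ :=
  ∑ r ∈ range (n + 1), (-1) ^ (n + r) * (n.choose r : ℚ) * diffSummand n (k + r) ℓ

lemma onePointSum_sub (n k ℓ : ℕ) (h : 0 < n + k) :
    onePointSum n k ℓ - onePointSum n k (ℓ + 1) = (n + ℓ) * diffSum n k ℓ := by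
  unfold onePointSum diffSum
  rw [mul_sum, mul_sum, mul_sum, ← sum_sub_distrib]
  refine sum_congr rfl fun r _ => ?_
  have := onePointSummand_sub n (k + r) ℓ (by omega)
  push_cast
  linear_combination (-1) ^ (n + r) * (n.choose r : ℚ) * this

lemma cast_choose_succ_right (n r : ℕ) :
    ((r : ℚ) + 1) * (n.choose (r + 1) : ℚ) = (n - r) * (n.choose r : ℚ) := by
  rcases le_or_gt r n with h | h
  · have := Nat.choose_succ_right_eq n r
    have : ((n.choose (r + 1) * (r + 1) : ℕ) : ℚ) = ((n.choose r * (n - r) : ℕ) : ℚ) := by rw [this]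
    push_cast [h] at this
    linarith
  · simp [Nat.choose_eq_zero_of_lt h, Nat.choose_eq_zero_of_lt (Nat.lt_succ_of_lt h)]

lemma diffSum_succ (n k ℓ : ℕ) (h : 0 < n + k) :
    ((ℓ : ℚ) - n) * (2 * k + n - ℓ - 1) * diffSum n k (ℓ + 1) =
      (ℓ + n) * (n + k - ℓ) * diffSum n k ℓ := by
  have key := sum_range_sub (fun r : ℕ => (-1 : ℚ) ^ (n + r) * (r * (n.choose r : ℚ)) *
    (2 * (2 * ((k : ℚ) + r) - 1) * diffSummand n (k + r) (ℓ + 1))) (n + 1)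
  simp only [Nat.choose_succ_self, Nat.cast_zero, mul_zero, zero_mul, sub_zero] at key
  rw [← sub_eq_zero, ← key]
  unfold diffSum
  rw [mul_sum, mul_sum, ← sum_sub_distrib]
  refine sum_congr rfl fun r _ => ?_
  have h1 := diffSummand_succ_right n (k + r) ℓ
  have h2 := diffSummand_succ_succ n (k + r) ℓ (by omega)
  have h3 := cast_choose_succ_right n r
  rw [← add_assoc k r 1, ← add_assoc n r 1, pow_succ]
  push_cast at h1 h2 ⊢
  rw [h3]
  linear_combination (-1) ^ (n + r) * (n.choose r : ℚ) *
    (((ℓ : ℚ) - n + 2 * r) * h1 + ((n : ℚ) - r) * h2)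

lemma diffSum_top (n k : ℕ) :
    diffSum n k (n + k) =
      ((n + k)! : ℚ) * ((2 * n + k - 1)! : ℚ) / ((2 * (n + k))! : ℚ) := by
  unfold diffSum
  rw [sum_range_succ, sum_eq_zero]
  · rw [diffSummand, if_pos (by omega), show k + n - (n + k) = 0 by omega, add_comm k n,
      show 2 * (n + k) + n - (n + k) - 1 = 2 * n + k - 1 by omega, ← two_mul]
    simp [pow_mul]
  · intro r hr
    rw [mem_range] at hr
    rw [diffSummand, if_neg (by omega), mul_zero]

/-- The Pfaff–Saalschütz evaluation of `diffSum`. -/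
lemma diffSum_eq (n k d : ℕ) : ∀ ℓ, 0 < n + k → ℓ + d = n + k →
    (2 * (k : ℚ) + n - ℓ) * (n + ℓ) * diffSum n k ℓ =
      ((2 * n + 1)! : ℚ) * ((n + k)! : ℚ) * ((n + ℓ).choose (2 * n + 1) : ℚ) *
        ((k + d)! : ℚ) / ((d ! : ℚ) * ((2 * (n + k))! : ℚ)) := by
  induction d with
  | zero =>
    intro ℓ h hl
    obtain rfl : ℓ = n + k := by omega
    rw [diffSum_top]
    have h0 := Nat.factorial_ne_zero (2 * (n + k))
    rcases k with _ | k
    · rw [Nat.choose_eq_zero_of_lt (by omega)]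
      push_cast
      simp
    · have h1 := Nat.choose_mul_factorial_mul_factorial
        (show 2 * n + 1 ≤ n + (n + (k + 1)) by omega)
      rw [show n + (n + (k + 1)) - (2 * n + 1) = k by omega,
        show n + (n + (k + 1)) = 2 * n + k + 1 by omega,
        Nat.factorial_succ (2 * n + k)] at h1
      have h2 : (((2 * n + k + 1).choose (2 * n + 1) * (2 * n + 1)! * k ! : ℕ) : ℚ) =
        (((2 * n + k + 1) * (2 * n + k)! : ℕ) : ℚ) := by rw [h1]
      push_cast at h2
      rw [show n + (n + (k + 1)) = 2 * n + k + 1 by omega,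
        show 2 * n + (k + 1) - 1 = 2 * n + k by omega, add_zero, Nat.factorial_succ k]
      push_cast
      field_simp
      simp only [Nat.factorial_zero, Nat.cast_one]
      linear_combination (-((k : ℚ) + 1)) * h2
  | succ d ih =>
    intro ℓ h hl
    have ih := ih (ℓ + 1) h (by omega)
    have hs := diffSum_succ n k ℓ h
    have hd : (n : ℚ) + k - ℓ = d + 1 := by
      have : (ℓ : ℚ) + (d + 1) = n + k := by exact_mod_cast hl
      linarith
    have hc : ((n : ℚ) + ℓ + 1) * ((n + ℓ).choose (2 * n + 1) : ℚ) =
        ((n + (ℓ + 1)).choose (2 * n + 1) : ℚ) * (ℓ - n) := by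
      have h1 := cast_choose_succ_right (n + ℓ) (2 * n)
      have h2 := Nat.choose_succ_succ (n + ℓ) (2 * n)
      have h3 : ((n + (ℓ + 1)).choose (2 * n + 1) : ℚ) =
          (n + ℓ).choose (2 * n) + (n + ℓ).choose (2 * n + 1) := by exact_mod_cast h2
      push_cast at h1
      linear_combination h1 - ((ℓ : ℚ) - n) * h3
    have hk : 2 * (k : ℚ) + n - ℓ = k + d + 1 := by linarith
    have n1 : (n : ℚ) + ℓ + 1 ≠ 0 := by positivity
    have n2 : (d : ℚ) + 1 ≠ 0 := by positivity
    have := Nat.factorial_ne_zero (2 * (n + k))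
    have := Nat.factorial_ne_zero d
    apply mul_left_cancel₀ (mul_ne_zero n1 n2)
    rw [← add_assoc k d 1, Nat.factorial_succ (k + d), Nat.factorial_succ d]
    rw [hd] at hs
    push_cast at ih ⊢
    rw [eq_div_iff (by positivity)] at ih
    rw [← mul_div_assoc, eq_div_iff (by positivity)]
    rw [hk] at hs ⊢
    rw [show 2 * (k : ℚ) + n - (ℓ + 1) = k + d + 1 - 1 by linarith] at ih
    linear_combination
      (-((n : ℚ) + ℓ + 1) * (k + d + 1) * ((d + 1) * d ! * (2 * (n + k))!)) * hs +
      ((ℓ : ℚ) - n) * (k + d + 1) * (d + 1) * ih -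
      ((d : ℚ) + 1) * (2 * n + 1)! * (n + k)! * (k + d + 1) * (k + d)! * hc

lemma choose_telescope (p q n : ℕ) :
    ∑ j ∈ range (n + 1),
      ((2 * (q : ℚ) - p) * ((p + 1).choose (2 * j + 1) : ℚ) * ((q + j).choose p : ℚ) -
        (p + 1) * ((p + 2).choose (2 * j + 1) : ℚ) * ((q + j).choose (p + 1) : ℚ)) =
      (p + 1) * (p.choose (2 * n + 1) : ℚ) * ((q + n + 1).choose (p + 1) : ℚ) := by
  have upper (j : ℕ) : ((p : ℚ) + 1) * ((q + j + 1).choose (p + 1) : ℚ) =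
      (q + j + 1) * ((q + j).choose p : ℚ) := by
    have := Nat.add_one_mul_choose_eq (q + j) p
    have : (((q + j + 1) * (q + j).choose p : ℕ) : ℚ) =
      (((q + j + 1).choose (p + 1) * (p + 1) : ℕ) : ℚ) := by rw [this]
    push_cast at this
    linarith
  induction n with
  | zero =>
    have h1 := cast_choose_succ_right q p
    have h2 := upper 0
    simp only [zero_add, sum_range_one, mul_zero, Nat.choose_one_right, add_zero,
      Nat.cast_zero] at h2 ⊢
    push_cast
    linear_combination (-((p : ℚ) + 2)) * h1 - p * h2
  | succ n ih =>
    rw [sum_range_succ, ih]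
    have h1 := cast_choose_succ_right (q + (n + 1)) p
    have h2 := upper (n + 1)
    have h3 := cast_choose_succ_right p (2 * n + 2)
    have h4 : ((p + 1).choose (2 * n + 3) : ℚ) =
        p.choose (2 * n + 2) + p.choose (2 * n + 3) := by
      exact_mod_cast Nat.choose_succ_succ p (2 * n + 2)
    have h5 : ((p + 1).choose (2 * n + 2) : ℚ) =
        p.choose (2 * n + 1) + p.choose (2 * n + 2) := by
      exact_mod_cast Nat.choose_succ_succ p (2 * n + 1)
    have h6 : ((p + 2).choose (2 * n + 3) : ℚ) =
        (p + 1).choose (2 * n + 2) + (p + 1).choose (2 * n + 3) := by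
      exact_mod_cast Nat.choose_succ_succ (p + 1) (2 * n + 2)
    rw [show 2 * (n + 1) + 1 = 2 * n + 3 by ring, h6, h5, h4,
      show q + n + 1 = q + (n + 1) by ring]
    push_cast at h1 h2 h3 ⊢
    set a : ℚ := (p.choose (2 * n + 1) : ℚ)
    set b : ℚ := (p.choose (2 * n + 2) : ℚ)
    set c : ℚ := (p.choose (2 * n + 3) : ℚ)
    linear_combination (a - (a + 2 * b + c)) * h1 - c * h2 -
      ((q + (n + 1)).choose p : ℚ) * h3

/-- The positive sum, indexed by `j = n - s`. -/
def positiveSum (n k ℓ : ℕ) : ℚ :=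
  (∑ j ∈ range (n + 1), ((n + ℓ + 1).choose (2 * j + 1) : ℚ) *
    ((n + k + j).choose (n + ℓ) : ℚ)) / ((2 * (n + k)).choose (n + ℓ) : ℚ)

lemma positiveSum_sub (n k ℓ : ℕ) (h : ℓ < n + k) :
    positiveSum n k ℓ - positiveSum n k (ℓ + 1) =
      ((n + ℓ).choose (2 * n + 1) : ℚ) * ((2 * n + k + 1).choose (n + ℓ + 1) : ℚ) /
        ((2 * (n + k)).choose (n + ℓ + 1) : ℚ) := by
  have ht := choose_telescope (n + ℓ) (n + k) n
  rw [sum_sub_distrib] at ht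
  simp only [mul_assoc] at ht
  rw [← mul_sum, ← mul_sum] at ht
  have hc := cast_choose_succ_right (2 * (n + k)) (n + ℓ)
  have c1 : ((2 * (n + k)).choose (n + ℓ) : ℚ) ≠ 0 := by
    exact_mod_cast (Nat.choose_pos (by omega)).ne'
  have c2 : ((2 * (n + k)).choose (n + ℓ + 1) : ℚ) ≠ 0 := by
    exact_mod_cast (Nat.choose_pos (by omega)).ne'
  have hp : (n : ℚ) + ℓ + 1 ≠ 0 := by positivity
  unfold positiveSum
  rw [show n + (ℓ + 1) = n + ℓ + 1 by ring, show n + ℓ + 1 + 1 = n + ℓ + 2 by ring]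
  rw [show n + k + n + 1 = 2 * n + k + 1 by ring] at ht
  push_cast at ht hc
  rw [div_sub_div _ _ c1 c2, div_eq_div_iff (mul_ne_zero c1 c2) c2]
  apply mul_left_cancel₀ hp
  set A := ∑ j ∈ range (n + 1), ((n + ℓ + 1).choose (2 * j + 1) : ℚ) *
    ((n + k + j).choose (n + ℓ) : ℚ)
  linear_combination ((2 * (n + k)).choose (n + ℓ + 1) : ℚ) * (A * hc +
    ((2 * (n + k)).choose (n + ℓ) : ℚ) * ht)

/-- The prefactor of the one-point function, without `n + ℓ + 1` and `n!`. -/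
def prefactor (n k : ℕ) : ℚ := ((k + 2 * n + 1)! : ℚ) / (((2 * n + 1)! : ℚ) * ((n + k)! : ℚ))

lemma prefactor_mul_onePointSum_top (n k : ℕ) :
    prefactor n k * onePointSum n k (n + k) = positiveSum n k (n + k) := by
  have hL : onePointSum n k (n + k) = ((n : ℚ) + (n + k) + 1) * (((n + k)! : ℚ) *
      ((2 * n + k)! : ℚ) * ((2 * n + k)! : ℚ) /
        (((2 * (n + k))! : ℚ) * ((2 * n + k + 1)! : ℚ))) := by
    unfold onePointSum
    rw [sum_range_succ, sum_eq_zero]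
    · rw [onePointSummand, if_pos (by omega), show k + n - (n + k) = 0 by omega, add_comm k n,
        show 2 * (n + k) + n - (n + k) = 2 * n + k by omega, ← two_mul,
        show n + (n + k) = 2 * n + k by omega]
      simp [pow_mul]
    · intro r hr
      rw [mem_range] at hr
      rw [onePointSummand, if_neg (by omega), mul_zero]
  have hR : positiveSum n k (n + k) = ((2 * n + k + 1).choose (2 * n + 1) : ℚ) /
      ((2 * (n + k)).choose (2 * n + k) : ℚ) := by
    unfold positiveSum
    rw [sum_range_succ, sum_eq_zero]
    · rw [show n + k + n = n + (n + k) by ring, Nat.choose_self,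
        show n + (n + k) = 2 * n + k by ring]
      simp
    · intro j hj
      rw [mem_range] at hj
      rw [Nat.choose_eq_zero_of_lt (show n + k + j < n + (n + k) by omega)]
      simp
  rw [hL, hR, prefactor, Nat.cast_choose ℚ (show 2 * n + 1 ≤ 2 * n + k + 1 by omega),
    Nat.cast_choose ℚ (show 2 * n + k ≤ 2 * (n + k) by omega),
    show 2 * n + k + 1 - (2 * n + 1) = k by omega, show 2 * (n + k) - (2 * n + k) = k by omega,
    show k + 2 * n + 1 = 2 * n + k + 1 by ring, Nat.factorial_succ (2 * n + k)]
  have := Nat.factorial_ne_zero (2 * n + k)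
  have := Nat.factorial_ne_zero (2 * n + 1)
  have := Nat.factorial_ne_zero (n + k)
  have := Nat.factorial_ne_zero (2 * (n + k))
  have := Nat.factorial_ne_zero k
  push_cast
  field_simp
  ring

lemma prefactor_mul_diffSum (n k ℓ : ℕ) (h : ℓ < n + k) :
    prefactor n k * ((n + ℓ) * diffSum n k ℓ) =
      ((n + ℓ).choose (2 * n + 1) : ℚ) * ((2 * n + k + 1).choose (n + ℓ + 1) : ℚ) /
        ((2 * (n + k)).choose (n + ℓ + 1) : ℚ) := by
  obtain ⟨d, hd⟩ := Nat.exists_eq_add_of_lt h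
  have hV := diffSum_eq n k (d + 1) ℓ (by omega) (by omega)
  have hk : 2 * (k : ℚ) + n - ℓ = k + d + 1 := by
    have : (n : ℚ) + k = ℓ + d + 1 := by exact_mod_cast hd
    linarith
  have hne : (k : ℚ) + d + 1 ≠ 0 := by positivity
  rw [hk] at hV
  rw [Nat.cast_choose ℚ (show n + ℓ + 1 ≤ 2 * n + k + 1 by omega),
    Nat.cast_choose ℚ (show n + ℓ + 1 ≤ 2 * (n + k) by omega),
    show 2 * n + k + 1 - (n + ℓ + 1) = d + 1 by omega,
    show 2 * (n + k) - (n + ℓ + 1) = k + d by omega, prefactor,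
    show k + 2 * n + 1 = 2 * n + k + 1 by ring]
  rw [← add_assoc k d 1, Nat.factorial_succ (k + d)] at hV
  have := Nat.factorial_ne_zero (2 * n + k + 1)
  have := Nat.factorial_ne_zero (2 * n + 1)
  have := Nat.factorial_ne_zero (n + k)
  have := Nat.factorial_ne_zero (2 * (n + k))
  have := Nat.factorial_ne_zero (k + d)
  have := Nat.factorial_ne_zero (d + 1)
  have := Nat.factorial_ne_zero (n + ℓ + 1)
  apply mul_left_cancel₀ hne
  rw [show ((k : ℚ) + d + 1) * (((2 * n + k + 1)! : ℚ) / (((2 * n + 1)! : ℚ) * ((n + k)! : ℚ)) *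
      ((n + ℓ) * diffSum n k ℓ)) = ((2 * n + k + 1)! : ℚ) / (((2 * n + 1)! : ℚ) * ((n + k)! : ℚ)) *
      ((k + d + 1) * (n + ℓ) * diffSum n k ℓ) by ring, hV]
  push_cast
  field_simp

lemma prefactor_mul_onePointSum (n k d : ℕ) : ∀ ℓ, ℓ + d = n + k →
    prefactor n k * onePointSum n k ℓ = positiveSum n k ℓ := by
  induction d with
  | zero =>
    rintro ℓ rfl
    exact prefactor_mul_onePointSum_top n k
  | succ d ih =>
    intro ℓ h
    have h1 := ih (ℓ + 1) (by omega)
    have h2 := onePointSum_sub n k ℓ (by omega)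
    have h3 := positiveSum_sub n k ℓ (by omega)
    have h4 := prefactor_mul_diffSum n k ℓ (by omega)
    linear_combination h1 + prefactor n k * h2 - h3 + h4

/-- The one-point function `H(n,k;ℓ)` for the non-intersecting Dyck path model,
computed by LU decomposition as an alternating sum, equals the manifestly
positive sum `(1/C(2n+2k, n+ℓ))·∑_{s=0}^{n} C(n+ℓ+1, 2n+1-2s)·C(2n+k-s, n+ℓ)`. -/
theorem dyck_one_point (n k ℓ : ℕ) (h : ℓ ≤ n + k) :
    ((n : ℚ) + ℓ + 1) * ((k + 2 * n + 1)! : ℚ) * (n ! : ℚ) /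
          (((2 * n + 1)! : ℚ) * ((n + k)! : ℚ)) *
        ∑ r ∈ Finset.range (n + 1), (-1 : ℚ) ^ (n + r) *
          (if ℓ ≤ k + r then
              ((k + r)! : ℚ) * ((n + k + r)! : ℚ) * ((2 * k + 2 * r + n - ℓ)! : ℚ) /
                (((2 * k + 2 * r)! : ℚ) * (r ! : ℚ) * ((n - r)! : ℚ) *
                  ((n + k + r + 1)! : ℚ) * ((k + r - ℓ)! : ℚ))
            else 0) =
      (1 / ((2 * n + 2 * k).choose (n + ℓ) : ℚ)) *
        ∑ s ∈ Finset.range (n + 1),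
          ((n + ℓ + 1).choose (2 * n + 1 - 2 * s) : ℚ) *
            ((2 * n + k - s).choose (n + ℓ) : ℚ) := by
  have main := prefactor_mul_onePointSum n k (n + k - ℓ) ℓ (by omega)
  have hR : positiveSum n k ℓ = (1 / ((2 * n + 2 * k).choose (n + ℓ) : ℚ)) *
      ∑ s ∈ Finset.range (n + 1), ((n + ℓ + 1).choose (2 * n + 1 - 2 * s) : ℚ) *
        ((2 * n + k - s).choose (n + ℓ) : ℚ) := by
    rw [positiveSum, ← sum_range_reflect, mul_add, div_eq_mul_one_div, mul_comm]
    congr 1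
    refine sum_congr rfl fun s hs => ?_
    rw [mem_range] at hs
    rw [show 2 * (n + 1 - 1 - s) + 1 = 2 * n + 1 - 2 * s by omega,
      show n + k + (n + 1 - 1 - s) = 2 * n + k - s by omega]
  rw [← hR, ← main, onePointSum, prefactor]
  have hsum : ∑ r ∈ range (n + 1), (-1 : ℚ) ^ (n + r) * (n.choose r : ℚ) *
      onePointSummand n (k + r) ℓ = (n ! : ℚ) * ∑ r ∈ Finset.range (n + 1), (-1 : ℚ) ^ (n + r) *
          (if ℓ ≤ k + r then
              ((k + r)! : ℚ) * ((n + k + r)! : ℚ) * ((2 * k + 2 * r + n - ℓ)! : ℚ) /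
                (((2 * k + 2 * r)! : ℚ) * (r ! : ℚ) * ((n - r)! : ℚ) *
                  ((n + k + r + 1)! : ℚ) * ((k + r - ℓ)! : ℚ))
            else 0) := by
    rw [mul_sum]
    refine sum_congr rfl fun r hr => ?_
    rw [mem_range] at hr
    rw [onePointSummand]
    split_ifs
    · rw [Nat.cast_choose ℚ (show r ≤ n by omega), mul_add, ← add_assoc n k r]
      have := Nat.factorial_ne_zero r
      have := Nat.factorial_ne_zero (n - r)
      have := Nat.factorial_ne_zero (2 * k + 2 * r)
      have := Nat.factorial_ne_zero (n + k + r + 1)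
      have := Nat.factorial_ne_zero (k + r - ℓ)
      field_simp
    · simp
  rw [hsum]
  ring
end

section
/- For all nonnegative integers k, n, ℓ with n ≥ ℓ, the alternating sum ∑_{r=0}^{n} (-1)^{n+r}·C(n+k+r, n+k)·C(k+r, ℓ)·C(2k+2r+n-ℓ, n-ℓ)·C(k+2n+1, n-r) equals C(2n+1, n-ℓ)·C(n+ℓ, n). -/
open Finset Nat

open Polynomial in
/-- Upper negation: `C(-(m + 1), d) = (-1)^d * C(m + d, d)`, cleared of denominators. -/
lemma descPochhammer_eval_neg_succ (m d : ℕ) :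
    (descPochhammer ℚ d).eval (-((m : ℚ) + 1)) = (-1) ^ d * (d ! * (m + d).choose d) := by
  have h := ascPochhammer_eval_neg_eq_descPochhammer ℚ (-((m : ℚ) + 1)) d
  rw [neg_neg, ← Nat.cast_succ, ← ascPochhammer_eval_cast, ascPochhammer_nat_eq_ascFactorial,
    Nat.ascFactorial_eq_factorial_mul_choose] at h
  push_cast at h
  rw [h, ← mul_assoc, ← mul_pow]
  simp

lemma fwdDiff_iter_one_div_succ (n m : ℕ) :
    (fwdDiff 1)^[n] (fun x : ℕ ↦ 1 / ((x : ℚ) + 1)) m =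
      (-1) ^ n * (n ! * m !) / (m + n + 1)! := by
  induction n generalizing m with
  | zero =>
    simp only [Function.iterate_zero, id_eq, add_zero, Nat.factorial_succ]
    have := Nat.factorial_ne_zero m
    push_cast
    field_simp
    simp
  | succ n ih =>
    rw [Function.iterate_succ_apply', fwdDiff, ih, ih, show m + 1 + n + 1 = m + n + 1 + 1 by ring,
      show m + (n + 1) + 1 = m + n + 1 + 1 by ring, Nat.factorial_succ (m + n + 1),
      Nat.factorial_succ m, Nat.factorial_succ n]
    have := Nat.factorial_ne_zero (m + n + 1)
    push_cast
    field_simp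
    ring

open Polynomial in
/-- Partial fractions: the alternating sum of `P (k + r) / (n + k + r + 1)` only sees the value
of `P` at the pole. -/
lemma alternating_sum_eval_div (P : ℚ[X]) (n k : ℕ) (hP : P.natDegree ≤ n) :
    ∑ r ∈ range (n + 1), (-1 : ℚ) ^ (n - r) * n.choose r *
        (P.eval ((k : ℚ) + r) / (n + k + r + 1)) =
      (-1) ^ n * (n ! * (n + k)!) / (2 * n + k + 1)! * P.eval (-((n : ℚ) + 1)) := by
  set a : ℚ := -((n : ℚ) + 1) with ha
  set Q := P /ₘ (X - C a) with hQ
  have hdiv : ∀ x, P.eval x = (x - a) * Q.eval x + P.eval a := fun x ↦ by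
    have h := congrArg (eval x) (modByMonic_add_div P (X - C a))
    rw [modByMonic_X_sub_C_eq_C_eval] at h
    simp only [eval_add, eval_mul, eval_sub, eval_X, eval_C] at h
    rw [← h]; ring
  have hQsum : ∑ r ∈ range (n + 1), (-1 : ℚ) ^ (n - r) * n.choose r * Q.eval ((k : ℚ) + r) = 0 := by
    rcases n.eq_zero_or_pos with rfl | hn
    · have : Q = 0 := by
        rw [hQ, divByMonic_eq_zero_iff (monic_X_sub_C a), degree_X_sub_C]
        exact (degree_le_of_natDegree_le hP).trans_lt (by simp)
      simp [this]
    · have hdeg : Q.natDegree < n := by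
        rw [hQ, natDegree_divByMonic _ (monic_X_sub_C a), natDegree_X_sub_C]
        omega
      have h := congrFun (fwdDiff_iter_eq_zero_of_degree_lt hdeg) (k : ℚ)
      rw [fwdDiff_iter_eq_sum_shift] at h
      simpa [zsmul_eq_mul] using h
  have hone : ∑ r ∈ range (n + 1), (-1 : ℚ) ^ (n - r) * n.choose r * (1 / (n + k + r + 1)) =
      (-1) ^ n * (n ! * (n + k)!) / (2 * n + k + 1)! := by
    have h := fwdDiff_iter_one_div_succ n (n + k)
    rw [fwdDiff_iter_eq_sum_shift] at h
    rw [show 2 * n + k + 1 = n + k + n + 1 by ring, ← h]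
    simp [zsmul_eq_mul]
  rw [← hone, Finset.sum_mul, ← zero_add (∑ r ∈ _, _ * eval a P), ← hQsum,
    ← Finset.sum_add_distrib]
  refine Finset.sum_congr rfl fun r _ ↦ ?_
  have : (n : ℚ) + k + r + 1 ≠ 0 := by positivity
  rw [hdiv, ha]
  field_simp
  ring

lemma choose_mul_choose_eq_div (n k r : ℕ) (hr : r ≤ n) :
    ((n + k + r).choose (n + k) : ℚ) * (k + 2 * n + 1).choose (n - r) =
      (2 * n + k + 1)! / (n ! * (n + k)!) * (n.choose r / (n + k + r + 1)) := by
  rw [Nat.cast_choose ℚ (show n + k ≤ n + k + r by omega),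
    Nat.cast_choose ℚ (show n - r ≤ k + 2 * n + 1 by omega), Nat.cast_choose ℚ hr,
    show n + k + r - (n + k) = r by omega,
    show k + 2 * n + 1 - (n - r) = n + k + r + 1 by omega, Nat.factorial_succ (n + k + r),
    show k + 2 * n + 1 = 2 * n + k + 1 by ring]
  have h1 := Nat.factorial_ne_zero (n + k + r)
  have h2 := Nat.factorial_ne_zero n
  push_cast
  field_simp

/-- For `n ≥ ℓ`, the alternating sum
`∑_{r=0}^{n} (-1)^{n+r}·C(n+k+r, n+k)·C(k+r, ℓ)·C(2k+2r+n-ℓ, n-ℓ)·C(k+2n+1, n-r)`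
equals `C(2n+1, n-ℓ)·C(n+ℓ, n)`. -/
theorem dyck_one_point_small_ell (k n ℓ : ℕ) (h : ℓ ≤ n) :
    ∑ r ∈ Finset.range (n + 1),
        (-1 : ℤ) ^ (n + r) * ((n + k + r).choose (n + k) : ℤ) * ((k + r).choose ℓ : ℤ) *
          ((2 * k + 2 * r + n - ℓ).choose (n - ℓ) : ℤ) * ((k + 2 * n + 1).choose (n - r) : ℤ) =
      ((2 * n + 1).choose (n - ℓ) : ℤ) * ((n + ℓ).choose n : ℤ) := by
  obtain ⟨d, rfl⟩ := Nat.exists_eq_add_of_le h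
  clear h
  set n := ℓ + d with hn
  have hd : n - ℓ = d := by omega
  set P : Polynomial ℚ := descPochhammer ℚ ℓ *
    (descPochhammer ℚ d).comp (Polynomial.C 2 * Polynomial.X + Polynomial.C (d : ℚ)) with hPdef
  have hP : P.natDegree ≤ n := by
    refine Polynomial.natDegree_mul_le.trans ?_
    rw [Polynomial.natDegree_comp, descPochhammer_natDegree, descPochhammer_natDegree,
      Polynomial.natDegree_linear two_ne_zero, mul_one]
  have hPnat : ∀ r : ℕ, P.eval ((k : ℚ) + r) =
      ℓ ! * d ! * ((k + r).choose ℓ * (2 * k + 2 * r + d).choose d) := fun r ↦ by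
    have h1 : (2 : ℚ) * (k + r) + d = ((2 * k + 2 * r + d : ℕ) : ℚ) := by push_cast; ring
    simp only [hPdef, Polynomial.eval_mul, Polynomial.eval_comp, Polynomial.eval_add,
      Polynomial.eval_C, Polynomial.eval_X]
    rw [h1, ← Nat.cast_add k r, descPochhammer_eval_eq_descFactorial,
      descPochhammer_eval_eq_descFactorial, Nat.descFactorial_eq_factorial_mul_choose,
      Nat.descFactorial_eq_factorial_mul_choose]
    push_cast
    ring
  have hPneg : P.eval (-((n : ℚ) + 1)) =
      ℓ ! * d ! * ((-1) ^ n * ((2 * n + 1).choose d * (n + ℓ).choose n)) := by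
    have h1 : (2 : ℚ) * -((n : ℚ) + 1) + d = -(((n + ℓ + 1 : ℕ) : ℚ) + 1) := by
      rw [hn]; push_cast; ring
    simp only [hPdef, Polynomial.eval_mul, Polynomial.eval_comp, Polynomial.eval_add,
      Polynomial.eval_C, Polynomial.eval_X]
    rw [h1, descPochhammer_eval_neg_succ, descPochhammer_eval_neg_succ,
      show n + ℓ + 1 + d = 2 * n + 1 by omega, ← Nat.choose_symm_add (a := n) (b := ℓ),
      show (-1 : ℚ) ^ n = (-1) ^ ℓ * (-1) ^ d by rw [hn, pow_add]]
    ring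
  have key := alternating_sum_eval_div P n k hP
  rw [hPneg] at key
  have hℓ : (ℓ ! : ℚ) ≠ 0 := by exact_mod_cast Nat.factorial_ne_zero ℓ
  have hd0 : (d ! : ℚ) ≠ 0 := by exact_mod_cast Nat.factorial_ne_zero d
  have hn0 : (n ! : ℚ) ≠ 0 := by exact_mod_cast Nat.factorial_ne_zero n
  have hnk : ((n + k)! : ℚ) ≠ 0 := by exact_mod_cast Nat.factorial_ne_zero (n + k)
  have hN : ((2 * n + k + 1)! : ℚ) ≠ 0 := by exact_mod_cast Nat.factorial_ne_zero (2 * n + k + 1)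
  have hsign : (-1 : ℚ) ^ n * (-1) ^ n = 1 := by rw [← mul_pow]; simp
  rw [hd, ← Int.cast_inj (α := ℚ)]
  push_cast
  calc _ = (2 * n + k + 1)! / (n ! * (n + k)!) / (ℓ ! * d !) *
        ∑ r ∈ range (n + 1), (-1 : ℚ) ^ (n - r) * n.choose r *
          (P.eval ((k : ℚ) + r) / (n + k + r + 1)) := by
        rw [Finset.mul_sum]
        refine Finset.sum_congr rfl fun r hr ↦ ?_
        have hrn : r ≤ n := Nat.lt_succ_iff.mp (Finset.mem_range.mp hr)
        have hpow : (-1 : ℚ) ^ (n + r) = (-1) ^ (n - r) := by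
          rw [show n + r = n - r + 2 * r by omega, pow_add, pow_mul]; simp
        rw [show 2 * k + 2 * r + n - ℓ = 2 * k + 2 * r + d by omega, hPnat, hpow]
        have hc := choose_mul_choose_eq_div n k r hrn
        calc _ = (-1 : ℚ) ^ (n - r) * ((k + r).choose ℓ * (2 * k + 2 * r + d).choose d) *
              (((n + k + r).choose (n + k) : ℚ) * (k + 2 * n + 1).choose (n - r)) := by ring
          _ = _ := by rw [hc]; field_simp
    _ = (-1 : ℚ) ^ n * (-1) ^ n * ((2 * n + 1).choose d * (n + ℓ).choose n) := by
        rw [key]; field_simp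
    _ = _ := by rw [hsign, one_mul]
end

section
/- For all nonnegative integers n, k, ℓ with n ≥ ℓ, one has ∑_{s=0}^{n} C(n+ℓ+1, 2n+1-2s)·C(2n+k-s, n+ℓ) = C(2n+2k, n+ℓ). -/
open Finset Nat

/-- The odd-index and even-index parts of the convolution of `C(m+1, j)` with `C(N + ⌊j/2⌋, m)`
are the single binomial coefficients `C(2N, m)` and `C(2N+1, m)`. -/
theorem sum_choose_odd_and_even (m : ℕ) : ∀ N K : ℕ,
    (m < 2 * K → ∑ t ∈ Finset.range K,
      (m + 1).choose (2 * t + 1) * (N + t).choose m = (2 * N).choose m) ∧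
    (m + 1 < 2 * K → ∑ t ∈ Finset.range K,
      (m + 1).choose (2 * t) * (N + t).choose m = (2 * N + 1).choose m) := by
  induction m with
  | zero =>
    intro N K
    constructor
    · intro hK
      obtain ⟨K, rfl⟩ : ∃ L, K = L + 1 := ⟨K - 1, by omega⟩
      rw [Finset.sum_range_succ', Finset.sum_eq_zero]
      · simp
      · intro t _
        rw [Nat.choose_eq_zero_of_lt (by omega), zero_mul]
    · intro hK
      obtain ⟨K, rfl⟩ : ∃ L, K = L + 1 := ⟨K - 1, by omega⟩
      rw [Finset.sum_range_succ', Finset.sum_eq_zero]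
      · simp
      · intro t _
        rw [Nat.choose_eq_zero_of_lt (by omega), zero_mul]
  | succ m ih =>
    intro N K
    constructor
    · intro hK
      induction N with
      | zero =>
        rw [Finset.sum_eq_zero]
        · simp
        · intro t _
          rcases Nat.lt_or_ge t (m + 1) with ht | ht
          · rw [Nat.choose_eq_zero_of_lt (show 0 + t < m + 1 by omega), mul_zero]
          · rw [Nat.choose_eq_zero_of_lt (show m + 1 + 1 < 2 * t + 1 by omega), zero_mul]
      | succ N ihN =>
        have hsplit : ∀ t, (m + 1 + 1).choose (2 * t + 1) * (N + 1 + t).choose (m + 1) =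
            ((m + 1).choose (2 * t + 1) * (N + t).choose m +
              (m + 1).choose (2 * t) * (N + t).choose m) +
            (m + 1 + 1).choose (2 * t + 1) * (N + t).choose (m + 1) := by
          intro t
          rw [show N + 1 + t = N + t + 1 by ring, Nat.choose_succ_succ (N + t) m, mul_add,
            Nat.choose_succ_succ (m + 1) (2 * t)]
          ring
        simp only [hsplit, Finset.sum_add_distrib]
        rw [ihN, (ih N K).1 (by omega), (ih N K).2 hK,
          show 2 * (N + 1) = 2 * N + 1 + 1 by ring, Nat.choose_succ_succ (2 * N + 1) m,
          Nat.choose_succ_succ (2 * N) m]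
        ring
    · intro hK
      induction N with
      | zero =>
        obtain ⟨K, rfl⟩ : ∃ L, K = L + 2 := ⟨K - 2, by omega⟩
        rw [Finset.sum_range_succ', Finset.sum_range_succ', Finset.sum_eq_zero]
        · rcases m with _ | m
          · simp
          · simp [Nat.choose_eq_zero_of_lt]
        · intro t _
          rcases Nat.lt_or_ge (t + 1 + 1) (m + 1) with ht | ht
          · rw [Nat.choose_eq_zero_of_lt (show 0 + (t + 1 + 1) < m + 1 by omega), mul_zero]
          · rw [Nat.choose_eq_zero_of_lt (show m + 1 + 1 < 2 * (t + 1 + 1) by omega), zero_mul]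
      | succ N ihN =>
        have hsplit : ∀ t, (m + 1 + 1).choose (2 * t) * (N + 1 + t).choose (m + 1) =
            (m + 1 + 1).choose (2 * t) * (N + t).choose m +
            (m + 1 + 1).choose (2 * t) * (N + t).choose (m + 1) := by
          intro t
          rw [show N + 1 + t = N + t + 1 by ring, Nat.choose_succ_succ (N + t) m, mul_add]
        have hshift : ∑ t ∈ Finset.range K, (m + 1 + 1).choose (2 * t) * (N + t).choose m =
            (2 * (N + 1)).choose m + (2 * N + 1).choose m := by
          rw [← (ih N K).2 (by omega), ← (ih (N + 1) (K - 1)).1 (by omega)]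
          obtain ⟨K, rfl⟩ : ∃ L, K = L + 1 := ⟨K - 1, by omega⟩
          rw [Finset.sum_range_succ', Finset.sum_range_succ' _ K, Nat.add_sub_cancel,
            ← add_assoc, ← Finset.sum_add_distrib]
          congr 1
          · refine Finset.sum_congr rfl fun t _ => ?_
            rw [show 2 * (t + 1) = 2 * t + 1 + 1 by ring,
              Nat.choose_succ_succ (m + 1) (2 * t + 1), show N + 1 + t = N + (t + 1) by ring]
            simp only [Nat.succ_eq_add_one]
            ring
        simp only [hsplit, Finset.sum_add_distrib]
        rw [ihN, hshift, show 2 * (N + 1) = 2 * N + 1 + 1 by ring,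
          Nat.choose_succ_succ (2 * N + 1 + 1) m, Nat.choose_succ_succ (2 * N + 1) m]
        simp only [Nat.succ_eq_add_one]
        ring

/-- For `n ≥ ℓ`,
`∑_{s=0}^{n} C(n+ℓ+1, 2n+1-2s)·C(2n+k-s, n+ℓ) = C(2n+2k, n+ℓ)`. -/
theorem binomial_convolution_identity (n k ℓ : ℕ) (h : ℓ ≤ n) :
    ∑ s ∈ Finset.range (n + 1),
        (n + ℓ + 1).choose (2 * n + 1 - 2 * s) * (2 * n + k - s).choose (n + ℓ) =
      (2 * n + 2 * k).choose (n + ℓ) := by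
  rw [← Finset.sum_range_reflect, ← mul_add,
    ← (sum_choose_odd_and_even (n + ℓ) (n + k) (n + 1)).1 (by omega)]
  refine Finset.sum_congr rfl fun t ht => ?_
  rw [Finset.mem_range] at ht
  rw [show 2 * n + 1 - 2 * (n + 1 - 1 - t) = 2 * t + 1 by omega,
    show 2 * n + k - (n + 1 - 1 - t) = n + k + t by omega]
end

section
/- Fix nonnegative integers n and ℓ with ℓ > n, and let (x)_m = x(x-1)⋯(x-m+1) denote the falling factorial. Define the polynomials (in a rational variable k): P_{n,ℓ}(k) = ∑_{r=0}^{n} (-4)^{n-r}·C(n,r)·(2k+2r+n-ℓ)_{2r}·(n+k+r)_r·(n+k-ℓ)_{n-r}·(k+2n+1)_{n-r}·(n+k-1/2)_{n-r} and Q_{n,ℓ}(k) = ((2n+1)!/(n+ℓ+1))·∑_{s=0}^{n} C(n+ℓ+1, 2n+1-2s)·(k+2n-s)_{n-s}·(n+k-ℓ)_s. Then for every integer j with 1 ≤ j ≤ n+1, P_{n,ℓ}(-j-n) = Q_{n,ℓ}(-j-n) = (-1)^n·(2n+1)!·(j-1)!·(n+2j+ℓ-1)! / ((n+ℓ+1)·(2j-1)!·(ℓ+j-1)!).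 -/
open Finset Nat

/-- The falling factorial `(x)_m = x(x-1)⋯(x-m+1)`. -/
def fallingFactorial (x : ℚ) (m : ℕ) : ℚ := ∏ i ∈ Finset.range m, (x - i)

theorem fallingFactorial_succ (x : ℚ) (m : ℕ) :
    fallingFactorial x (m + 1) = fallingFactorial x m * (x - m) :=
  Finset.prod_range_succ _ _

theorem fallingFactorial_natCast (a m : ℕ) :
    fallingFactorial (a : ℚ) m = (a.descFactorial m : ℚ) := by
  rw [← descPochhammer_eval_eq_descFactorial]
  induction m with
  | zero => simp [fallingFactorial]
  | succ m ih => rw [fallingFactorial_succ, descPochhammer_succ_eval, ih]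

theorem fallingFactorial_neg_mul_factorial (a m : ℕ) :
    fallingFactorial (-((a : ℚ) + 1)) m * (a ! : ℚ) = (-1) ^ m * ((a + m)! : ℚ) := by
  induction m with
  | zero => simp [fallingFactorial]
  | succ m ih =>
    rw [fallingFactorial_succ, mul_right_comm, ih, ← add_assoc, Nat.factorial_succ]
    push_cast
    ring

theorem fallingFactorial_neg (a m : ℕ) :
    fallingFactorial (-((a : ℚ) + 1)) m = (-1) ^ m * ((a + m)! : ℚ) / (a ! : ℚ) := by
  rw [eq_div_iff (by positivity), fallingFactorial_neg_mul_factorial]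

theorem fallingFactorial_neg_half_mul (p d : ℕ) :
    (-4 : ℚ) ^ d * fallingFactorial (-((p : ℚ) + 1) - 1 / 2) d * ((p + d)! : ℚ) *
      ((2 * p + 1)! : ℚ) = ((2 * (p + d) + 1)! : ℚ) * (p ! : ℚ) := by
  induction d with
  | zero => simp [fallingFactorial, mul_comm]
  | succ d ih =>
    have h : 2 * (p + (d + 1)) + 1 = 2 * (p + d) + 1 + 1 + 1 := by ring
    rw [fallingFactorial_succ, pow_succ, h, ← add_assoc, Nat.factorial_succ (p + d),
      Nat.factorial_succ (2 * (p + d) + 1 + 1), Nat.factorial_succ (2 * (p + d) + 1)]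
    push_cast
    linear_combination (2 * (2 * (p + d : ℚ) + 3) * (p + d + 1)) * ih

theorem sum_range_two_mul {M : Type*} [AddCommMonoid M] (f : ℕ → M) (n : ℕ) :
    ∑ k ∈ range (2 * n), f k = ∑ m ∈ range n, (f (2 * m) + f (2 * m + 1)) := by
  induction n with
  | zero => simp
  | succ n ih => rw [mul_add_one, sum_range_succ, sum_range_succ, ih, sum_range_succ, add_assoc]

open PowerSeries in
theorem one_add_X_pow_mul_expand_invOneSubPow (N : ℕ) :
    (1 + X : ℚ⟦X⟧) ^ N * expand 2 two_ne_zero (invOneSubPow ℚ N).val =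
      (invOneSubPow ℚ N).val := by
  have h : (invOneSubPow ℚ N).val * (1 - X) ^ N = 1 := by
    rw [← invOneSubPow_inv_eq_one_sub_pow]
    exact (invOneSubPow ℚ N).val_inv
  have h' := congrArg (expand 2 two_ne_zero) h
  simp only [map_mul, map_pow, map_sub, map_one, expand_X] at h'
  have hX : (1 - X ^ 2 : ℚ⟦X⟧) = (1 + X) * (1 - X) := by ring
  rw [hX, mul_pow] at h'
  linear_combination (-(1 + X : ℚ⟦X⟧) ^ N * expand 2 two_ne_zero (invOneSubPow ℚ N).val) * h +
    (invOneSubPow ℚ N).val * h'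

open PowerSeries in
theorem sum_choose_odd_mul_choose (N p : ℕ) :
    ∑ m ∈ range (p + 1), ((N + 1).choose (2 * m + 1) : ℚ) * ((N + (p - m)).choose N : ℚ) =
      ((N + (2 * p + 1)).choose N : ℚ) := by
  have h := congrArg (coeff (2 * p + 1)) (one_add_X_pow_mul_expand_invOneSubPow (N + 1))
  have hc (i : ℕ) : coeff i ((1 + X : ℚ⟦X⟧) ^ (N + 1)) = ((N + 1).choose i : ℚ) := by
    have := Polynomial.coeff_one_add_X_pow ℚ (N + 1) i
    rw [← this, ← Polynomial.coeff_coe]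
    simp
  rw [coeff_mul, Finset.Nat.sum_antidiagonal_eq_sum_range_succ
    (fun i k => coeff i ((1 + X : ℚ⟦X⟧) ^ (N + 1)) *
      coeff k (expand 2 two_ne_zero (invOneSubPow ℚ (N + 1)).val)),
    show (2 * p + 1).succ = 2 * (p + 1) by lia, sum_range_two_mul,
    invOneSubPow_val_succ_eq_mk_add_choose, coeff_mk] at h
  rw [← h]
  refine sum_congr rfl fun m hm => ?_
  have hm : m ≤ p := by simpa [Nat.lt_succ_iff] using hm
  rw [hc, hc, coeff_expand_of_not_dvd _ _ _ (by lia),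
    show 2 * p + 1 - (2 * m + 1) = 2 * (p - m) by lia, coeff_expand_mul, coeff_mk]
  simp

theorem sum_choose_odd_mul_factorial_div (N p : ℕ) :
    ∑ m ∈ range (p + 1),
        ((N + 1).choose (2 * m + 1) : ℚ) * ((N + (p - m))! : ℚ) / ((p - m)! : ℚ) =
      ((N + (2 * p + 1))! : ℚ) / ((2 * p + 1)! : ℚ) := by
  have hc (k : ℕ) : ((N + k)! : ℚ) / (k ! : ℚ) = (N ! : ℚ) * ((N + k).choose N : ℚ) := by
    rw [Nat.cast_add_choose]
    field_simp
  rw [hc, ← sum_choose_odd_mul_choose, mul_sum]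
  refine sum_congr rfl fun m _ => ?_
  rw [mul_div_assoc, hc]
  ring

theorem sum_P_eq (p d ℓ : ℕ) :
    ∑ r ∈ range (p + d + 1), (-4 : ℚ) ^ (p + d - r) * ((p + d).choose r : ℚ) *
        fallingFactorial (2 * r - 3 * p - d - ℓ - 2) (2 * r) *
        fallingFactorial ((r : ℚ) - p - 1) r *
        fallingFactorial (-((ℓ + p : ℕ) + 1 : ℚ)) (p + d - r) *
        fallingFactorial (d : ℚ) (p + d - r) *
        fallingFactorial (-((p : ℚ) + 1) - 1 / 2) (p + d - r) =
      (-1) ^ (p + d) * ((2 * (p + d) + 1)! : ℚ) * (p ! : ℚ) * ((p + d + ℓ + 1 + 2 * p)! : ℚ) /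
        (((p + d : ℕ) + ℓ + 1) * ((2 * p + 1)! : ℚ) * ((ℓ + p)! : ℚ)) := by
  rw [sum_eq_single_of_mem p (by simp)]
  · rw [Nat.add_sub_cancel_left, fallingFactorial_natCast, Nat.descFactorial_self,
      show (2 * p - 3 * p - d - ℓ - 2 : ℚ) = -((p + d + ℓ + 1 : ℕ) + 1) by push_cast; ring,
      show (p - p - 1 : ℚ) = -((0 : ℕ) + 1) by push_cast; ring,
      fallingFactorial_neg, fallingFactorial_neg, fallingFactorial_neg, Nat.cast_add_choose,
      Nat.factorial_succ (p + d + ℓ)]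
    have h := fallingFactorial_neg_half_mul p d
    rw [show ℓ + p + d = p + d + ℓ by ring, zero_add, pow_mul, neg_one_sq, one_pow]
    generalize fallingFactorial (-((p : ℚ) + 1) - 1 / 2) d = F at h ⊢
    push_cast
    field_simp
    rw [pow_add]
    linear_combination ((-1) ^ p * (-1) ^ d : ℚ) * h
  · intro r hr hrp
    rcases lt_or_gt_of_ne hrp with h | h
    · rw [fallingFactorial_natCast d, Nat.descFactorial_of_lt (by lia)]
      simp
    · obtain ⟨k, rfl⟩ := Nat.exists_eq_add_of_lt h
      rw [show (((p + k + 1 : ℕ) : ℚ) - p - 1) = (k : ℕ) by push_cast; ring,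
        fallingFactorial_natCast k, Nat.descFactorial_of_lt (by lia)]
      simp

theorem sum_Q_eq (n p ℓ : ℕ) (hp : p ≤ n) :
    ∑ s ∈ range (n + 1), ((n + ℓ + 1).choose (2 * n + 1 - 2 * s) : ℚ) *
        fallingFactorial ((n : ℚ) - s - p - 1) (n - s) *
        fallingFactorial (-((ℓ + p : ℕ) + 1 : ℚ)) s =
      (-1) ^ n * (p ! : ℚ) * ((n + ℓ + (2 * p + 1))! : ℚ) /
        (((2 * p + 1)! : ℚ) * ((ℓ + p)! : ℚ)) := by
  have hR : (-1) ^ n * (p ! : ℚ) * ((n + ℓ + (2 * p + 1))! : ℚ) /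
        (((2 * p + 1)! : ℚ) * ((ℓ + p)! : ℚ)) = (-1) ^ n * (p ! : ℚ) / ((ℓ + p)! : ℚ) *
        (((n + ℓ + (2 * p + 1))! : ℚ) / ((2 * p + 1)! : ℚ)) := by
    field_simp
  rw [hR, ← sum_choose_odd_mul_factorial_div, mul_sum, ← sum_range_reflect,
    ← sum_subset (range_subset_range.2 (Nat.succ_le_succ hp))]
  · refine sum_congr rfl fun m hm => ?_
    obtain ⟨q, rfl⟩ := Nat.exists_eq_add_of_le (Nat.lt_succ_iff.1 (mem_range.1 hm))
    obtain ⟨e, rfl⟩ := Nat.exists_eq_add_of_le hp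
    rw [show m + q + e + 1 - 1 - m = q + e by lia,
      show 2 * (m + q + e) + 1 - 2 * (q + e) = 2 * m + 1 by lia,
      show m + q + e - (q + e) = m by lia, Nat.add_sub_cancel_left,
      show ((m + q + e : ℕ) - (q + e : ℕ) - (m + q : ℕ) - 1 : ℚ) = -((q : ℕ) + 1) by
        push_cast; ring,
      fallingFactorial_neg, fallingFactorial_neg,
      show ℓ + (m + q) + (q + e) = m + q + e + ℓ + q by ring, add_comm q m]
    field_simp
    ring
  · intro m hm hmp
    have hm : m ≤ n := by simpa [Nat.lt_succ_iff] using hm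
    obtain ⟨k, rfl⟩ := Nat.exists_eq_add_of_lt (show p < m by simpa using hmp)
    obtain ⟨e, rfl⟩ := Nat.exists_eq_add_of_le hm
    rw [show p + k + 1 + e + 1 - 1 - (p + k + 1) = e by lia,
      show ((p + k + 1 + e : ℕ) - (e : ℕ) - p - 1 : ℚ) = (k : ℕ) by push_cast; ring,
      fallingFactorial_natCast, Nat.descFactorial_of_lt (by lia)]
    simp

/-- For `ℓ > n` and `1 ≤ j ≤ n+1`, the polynomials `P_{n,ℓ}` and `Q_{n,ℓ}`
agree at the point `k = -j-n`, where they both take the value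
`(-1)^n·(2n+1)!·(j-1)!·(n+2j+ℓ-1)!/((n+ℓ+1)·(2j-1)!·(ℓ+j-1)!)`. -/
theorem P_eq_Q_at_special_points (n ℓ j : ℕ) (hℓ : n < ℓ) (hj1 : 1 ≤ j) (hj2 : j ≤ n + 1)
    (K : ℚ) (hK : K = -(j : ℚ) - n) :
    (∑ r ∈ Finset.range (n + 1), (-4 : ℚ) ^ (n - r) * (n.choose r : ℚ) *
          fallingFactorial (2 * K + 2 * r + n - ℓ) (2 * r) *
          fallingFactorial ((n : ℚ) + K + r) r *
          fallingFactorial ((n : ℚ) + K - ℓ) (n - r) *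
          fallingFactorial (K + 2 * n + 1) (n - r) *
          fallingFactorial ((n : ℚ) + K - 1 / 2) (n - r) =
        (-1 : ℚ) ^ n * ((2 * n + 1)! : ℚ) * ((j - 1)! : ℚ) * ((n + 2 * j + ℓ - 1)! : ℚ) /
          (((n : ℚ) + ℓ + 1) * ((2 * j - 1)! : ℚ) * ((ℓ + j - 1)! : ℚ))) ∧
      (((2 * n + 1)! : ℚ) / ((n : ℚ) + ℓ + 1) *
          ∑ s ∈ Finset.range (n + 1), ((n + ℓ + 1).choose (2 * n + 1 - 2 * s) : ℚ) *
            fallingFactorial (K + 2 * n - s) (n - s) *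
            fallingFactorial ((n : ℚ) + K - ℓ) s =
        (-1 : ℚ) ^ n * ((2 * n + 1)! : ℚ) * ((j - 1)! : ℚ) * ((n + 2 * j + ℓ - 1)! : ℚ) /
          (((n : ℚ) + ℓ + 1) * ((2 * j - 1)! : ℚ) * ((ℓ + j - 1)! : ℚ))) := by
  obtain ⟨p, rfl⟩ := Nat.exists_eq_add_of_le' hj1
  obtain ⟨d, rfl⟩ := Nat.exists_eq_add_of_le (Nat.le_of_succ_le_succ hj2)
  subst hK
  have h2 : 2 * (p + 1) - 1 = 2 * p + 1 := by lia
  have h3 : ℓ + (p + 1) - 1 = ℓ + p := by lia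
  rw [h2, h3, Nat.add_sub_cancel]
  constructor
  · rw [show p + d + 2 * (p + 1) + ℓ - 1 = p + d + ℓ + 1 + 2 * p by lia, ← sum_P_eq]
    refine sum_congr rfl fun r _ => ?_
    push_cast
    ring_nf
  · rw [show p + d + 2 * (p + 1) + ℓ - 1 = p + d + ℓ + (2 * p + 1) by lia]
    have h := sum_Q_eq (p + d) p ℓ (by lia)
    rw [show ∀ a b c e x y z : ℚ, a * b * c * e / (x * y * z) = b / x * (a * c * e / (y * z)) by
      intros; field_simp, ← h]
    congr 1
    refine sum_congr rfl fun s _ => ?_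
    push_cast
    ring_nf
end

section
/- For all integers n ≥ 0, ℓ > n, and 1 ≤ j ≤ n+1, one has ∑_{s=n-j+1}^{n} C(n+ℓ+1, 2n+1-2s)·C(j+ℓ+s-1, n+ℓ) = C(2j+n+ℓ-1, n+ℓ); equivalently, the sum divided by C(2j+n+ℓ-1, n+ℓ) equals 1. -/
open Finset Nat

/-- The power series `(1 - X)⁻¹ ^ (d + 1)` equals `(1 + X) ^ (d + 1) * (1 - X ^ 2)⁻¹ ^ (d + 1)`. -/
theorem one_add_X_pow_mul_expand_two_mk_choose (d : ℕ) :
    ((1 + Polynomial.X : Polynomial ℤ) ^ (d + 1) : PowerSeries ℤ) *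
        PowerSeries.expand 2 two_ne_zero (PowerSeries.mk fun i ↦ ((d + i).choose d : ℤ)) =
      PowerSeries.mk fun i ↦ ((d + i).choose d : ℤ) := by
  have hP := PowerSeries.mk_add_choose_mul_one_sub_pow_eq_one ℤ d
  have hQ := congrArg (PowerSeries.expand 2 two_ne_zero) hP
  simp only [map_mul, map_pow, map_sub, map_one, PowerSeries.expand_X] at hQ
  have hfac : (1 - PowerSeries.X ^ 2 : PowerSeries ℤ) =
      (1 + PowerSeries.X) * (1 - PowerSeries.X) := by ring
  rw [hfac, mul_pow] at hQ
  push_cast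
  linear_combination (PowerSeries.mk fun i ↦ ((d + i).choose d : ℤ)) * hQ -
    (1 + PowerSeries.X) ^ (d + 1) *
      PowerSeries.expand 2 two_ne_zero (PowerSeries.mk fun i ↦ ((d + i).choose d : ℤ)) * hP

theorem sum_range_choose_odd_mul_choose (d k : ℕ) :
    ∑ i ∈ range (k + 1), (d + 1).choose (2 * (k - i) + 1) * (d + i).choose d =
      (d + (2 * k + 1)).choose d := by
  have h := congrArg (PowerSeries.coeff (2 * k + 1))
    (one_add_X_pow_mul_expand_two_mk_choose d)
  rw [PowerSeries.coeff_mul, PowerSeries.coeff_mk] at h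
  zify
  rw [← h]
  refine sum_of_injOn (fun i ↦ (2 * (k - i) + 1, 2 * i)) ?_ ?_ ?_ ?_
  · intro a _ b _ hab
    simp only [Prod.mk.injEq] at hab
    omega
  · intro i hi
    simp only [coe_range, Set.mem_Iio, mem_coe,
      HasAntidiagonal.mem_antidiagonal] at hi ⊢
    omega
  · rintro ⟨a, b⟩ hab hnot
    have hb : ¬ 2 ∣ b := by
      rintro ⟨i, rfl⟩
      rw [HasAntidiagonal.mem_antidiagonal] at hab
      refine hnot ⟨i, ?_, ?_⟩
      · simp only [coe_range, Set.mem_Iio]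
        omega
      · simp only [Prod.mk.injEq, and_true]
        omega
    rw [PowerSeries.coeff_expand_of_not_dvd _ _ _ hb, mul_zero]
  · intro i _
    rw [PowerSeries.coeff_expand_mul, PowerSeries.coeff_mk, ← Polynomial.coe_pow,
      Polynomial.coeff_coe, Polynomial.coeff_one_add_X_pow]

/-- For `n ≥ 0`, `ℓ > n` and `1 ≤ j ≤ n+1`,
`∑_{s=n-j+1}^{n} C(n+ℓ+1, 2n+1-2s)·C(j+ℓ+s-1, n+ℓ) = C(2j+n+ℓ-1, n+ℓ)`. -/
theorem binomial_sum_Icc (n ℓ j : ℕ) (hℓ : n < ℓ) (hj1 : 1 ≤ j) (hj2 : j ≤ n + 1) :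
    ∑ s ∈ Finset.Icc (n + 1 - j) n,
        (n + ℓ + 1).choose (2 * n + 1 - 2 * s) * (j + ℓ + s - 1).choose (n + ℓ) =
      (2 * j + n + ℓ - 1).choose (n + ℓ) := by
  obtain ⟨k, rfl⟩ := Nat.exists_eq_add_of_le' hj1
  have hIcc : Icc (n + 1 - (k + 1)) n = Ico (n - k) (n + 1) := by
    ext s
    simp only [mem_Icc, mem_Ico]
    omega
  have hlen : n + 1 - (n - k) = k + 1 := by omega
  have htop : 2 * (k + 1) + n + ℓ - 1 = n + ℓ + (2 * k + 1) := by omega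
  rw [hIcc, sum_Ico_eq_sum_range, hlen, htop, ← sum_range_choose_odd_mul_choose]
  refine sum_congr rfl fun i hi ↦ ?_
  rw [mem_range] at hi
  congr 2 <;> omega
end

section
/- For all integers n ≥ 0 and k ≥ 1, the determinant of the k×k matrix with (i,j) entry C(j+n+1, 2j-i), for 0 ≤ i,j ≤ k-1 (with the entry equal to 0 when 2j < i), equals ∏_{i=0}^{k-1} (2n+2+2i)!·i! / ((2n+2+i)!·(2i)!). -/
open Finset Nat

open Polynomial in
/-- Determinants of evaluations of polynomials of degree less than `k` factor through a
Vandermonde determinant, so they are unchanged when all nodes are translated. -/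
theorem det_eval_add_eq {R : Type*} [CommRing R] {k : ℕ} (p : Fin k → R[X])
    (hp : ∀ i, (p i).natDegree < k) (v : Fin k → R) (a : R) :
    Matrix.det (Matrix.of fun i j => (p i).eval (v j + a)) =
      Matrix.det (Matrix.of fun i j => (p i).eval (v j)) := by
  have key : ∀ w : Fin k → R, Matrix.det (Matrix.of fun i j => (p i).eval (w j)) =
      Matrix.det (Matrix.of fun i j : Fin k => (p i).coeff j) *
        (Matrix.vandermonde w).det := by
    intro w
    rw [← Matrix.det_transpose (Matrix.vandermonde w), ← Matrix.det_mul]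
    congr 1
    ext i j
    simp only [Matrix.mul_apply, Matrix.of_apply, Matrix.transpose_apply,
      Matrix.vandermonde_apply]
    rw [eval_eq_sum_range' (hp i), Finset.sum_range]
  rw [key v, key fun j => v j + a, Matrix.det_vandermonde_add]

open Polynomial in
/-- The polynomial `(2X)(2X-1)⋯(2X-i+1) · (m+N-X)(m+N-1-X)⋯(m+i+1-X)`. -/
noncomputable def halfHexagonPoly (m N i : ℕ) : ℚ[X] :=
  (descPochhammer ℚ i).comp (C 2 * X) *
    (descPochhammer ℚ (N - i)).comp (C ((m + N : ℕ) : ℚ) - X)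

theorem natDegree_halfHexagonPoly_le {m N i : ℕ} (hi : i ≤ N) :
    (halfHexagonPoly m N i).natDegree ≤ N := by
  have h1 : ((Polynomial.C 2 * Polynomial.X : Polynomial ℚ)).natDegree ≤ 1 := by
    compute_degree
  have h2 : (Polynomial.C ((m + N : ℕ) : ℚ) - Polynomial.X).natDegree ≤ 1 := by
    compute_degree
  refine Polynomial.natDegree_mul_le.trans ?_
  rw [Polynomial.natDegree_comp, Polynomial.natDegree_comp,
    descPochhammer_natDegree, descPochhammer_natDegree]
  nlinarith [Nat.mul_le_mul_left i h1, Nat.mul_le_mul_left (N - i) h2, Nat.sub_add_cancel hi]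

theorem eval_halfHexagonPoly {m N i x : ℕ} (hx : x ≤ m + N) :
    (halfHexagonPoly m N i).eval (x : ℚ) =
      ((2 * x).descFactorial i * (m + N - x).descFactorial (N - i) : ℕ) := by
  have h1 : (2 * (x : ℚ)) = ((2 * x : ℕ) : ℚ) := by push_cast; ring
  rw [halfHexagonPoly, Polynomial.eval_mul, Polynomial.eval_comp, Polynomial.eval_comp,
    Polynomial.eval_mul, Polynomial.eval_C, Polynomial.eval_X, Polynomial.eval_sub,
    Polynomial.eval_C, Polynomial.eval_X, h1, ← Nat.cast_sub hx,
    descPochhammer_eval_eq_descFactorial, descPochhammer_eval_eq_descFactorial, Nat.cast_mul]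

theorem choose_mul_factorial_eq_descFactorial {m N i j : ℕ} (hi : i ≤ N) (hj : j ≤ N) :
    (if i ≤ 2 * j then (j + m).choose (2 * j - i) else 0) * ((2 * j)! * (m + N - j)!) =
      (j + m)! * ((2 * j).descFactorial i * (m + N - j).descFactorial (N - i)) := by
  split_ifs with h
  · rcases le_or_gt j (m + i) with h' | h'
    · have e1 := Nat.factorial_mul_descFactorial h
      have e2 := Nat.factorial_mul_descFactorial (show N - i ≤ m + N - j by omega)
      have e3 := Nat.choose_mul_factorial_mul_factorial (show 2 * j - i ≤ j + m by omega)
      rw [show m + N - j - (N - i) = m + i - j by omega] at e2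
      rw [show j + m - (2 * j - i) = m + i - j by omega] at e3
      rw [← e1, ← e2, ← e3]
      ring
    · rw [Nat.choose_eq_zero_of_lt (by omega),
        Nat.descFactorial_of_lt (show m + N - j < N - i by omega)]
      simp
  · rw [Nat.descFactorial_of_lt (show 2 * j < i by omega)]
    simp

/-- Translating the nodes by `m` makes the matrix of values triangular. -/
theorem det_halfHexagonPoly (m N : ℕ) :
    Matrix.det (Matrix.of fun i j : Fin (N + 1) =>
        (halfHexagonPoly m N i).eval ((j : ℕ) : ℚ)) =
      ∏ j ∈ range (N + 1), ((2 * (j + m)).descFactorial j * (N - j)! : ℚ) := by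
  rw [← det_eval_add_eq _ (fun i => Nat.lt_succ_of_le
    (natDegree_halfHexagonPoly_le (Nat.le_of_lt_succ i.2))) _ (m : ℚ)]
  have heval : ∀ i j : Fin (N + 1),
      (halfHexagonPoly m N i).eval (((j : ℕ) : ℚ) + m) =
        ((2 * (j + m)).descFactorial i * (N - j).descFactorial (N - i) : ℕ) := by
    intro i j
    rw [← Nat.cast_add, eval_halfHexagonPoly (by omega),
      show m + N - ((j : ℕ) + m) = N - j by omega]
  simp only [heval]
  rw [Matrix.det_of_isLowerTriangular, Finset.prod_range]
  · simp [Nat.descFactorial_self]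
  · intro i j hij
    have hij' : (i : ℕ) < j := hij
    rw [Matrix.of_apply, Nat.descFactorial_of_lt (show N - (j : ℕ) < N - i by omega)]
    simp

/-- The determinant of the k×k matrix with entries `C(j+n+1, 2j-i)` (zero when `2j < i`)
equals `∏_{i=0}^{k-1} (2n+2+2i)!·i!/((2n+2+i)!·(2i)!)`. -/
theorem half_hexagon_det (n k : ℕ) (hk : 1 ≤ k) :
    Matrix.det (Matrix.of fun i j : Fin k =>
        if (i : ℕ) ≤ 2 * (j : ℕ) then
          (((j : ℕ) + n + 1).choose (2 * (j : ℕ) - (i : ℕ)) : ℚ)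
        else 0) =
      ∏ i ∈ Finset.range k,
        ((2 * n + 2 + 2 * i)! : ℚ) * (i ! : ℚ) / (((2 * n + 2 + i)! : ℚ) * ((2 * i)! : ℚ)) := by
  obtain ⟨N, rfl⟩ : ∃ N, k = N + 1 := ⟨k - 1, by omega⟩
  have hfac : ∀ a : ℕ, (a ! : ℚ) ≠ 0 := fun a => Nat.cast_ne_zero.mpr a.factorial_ne_zero
  have hentry : ∀ i j : Fin (N + 1),
      (if (i : ℕ) ≤ 2 * (j : ℕ) then
          (((j : ℕ) + n + 1).choose (2 * (j : ℕ) - (i : ℕ)) : ℚ) else 0) =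
        ((j + (n + 1))! : ℚ) / ((2 * j)! * (n + 1 + N - j)!) *
          (halfHexagonPoly (n + 1) N i).eval ((j : ℕ) : ℚ) := by
    intro i j
    have h := choose_mul_factorial_eq_descFactorial (m := n + 1)
      (Nat.le_of_lt_succ i.2) (Nat.le_of_lt_succ j.2)
    rw [eval_halfHexagonPoly (by omega), div_mul_eq_mul_div,
      eq_div_iff (mul_ne_zero (hfac _) (hfac _))]
    exact_mod_cast h
  have hreflect : ∏ j ∈ range (N + 1), (((n + 1 + N - j)! : ℚ) / (N - j)!) =
      ∏ j ∈ range (N + 1), (((j + (n + 1))! : ℚ) / j !) := by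
    rw [← Finset.prod_range_reflect]
    refine Finset.prod_congr rfl fun j hj => ?_
    have := Finset.mem_range.mp hj
    rw [show n + 1 + N - (N + 1 - 1 - j) = j + (n + 1) by omega,
      show N - (N + 1 - 1 - j) = j by omega]
  simp only [hentry]
  have hrow := Matrix.det_mul_row
    (fun j : Fin (N + 1) => ((j + (n + 1))! : ℚ) / ((2 * j)! * (n + 1 + N - j)!))
    (Matrix.of fun i j : Fin (N + 1) => (halfHexagonPoly (n + 1) N i).eval ((j : ℕ) : ℚ))
  simp only [Matrix.of_apply] at hrow
  rw [hrow, det_halfHexagonPoly,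
    ← Finset.prod_range fun j => ((j + (n + 1))! : ℚ) / ((2 * j)! * (n + 1 + N - j)!),
    ← Finset.prod_mul_distrib]
  have hne : ∏ j ∈ range (N + 1), (((n + 1 + N - j)! : ℚ) / (N - j)!) ≠ 0 :=
    Finset.prod_ne_zero_iff.mpr fun j _ => div_ne_zero (hfac _) (hfac _)
  refine mul_right_cancel₀ hne ?_
  nth_rewrite 2 [hreflect]
  rw [← Finset.prod_mul_distrib, ← Finset.prod_mul_distrib]
  refine Finset.prod_congr rfl fun j _ => ?_
  have hdesc : ((2 * n + 2 + j)! : ℚ) * (2 * (j + (n + 1))).descFactorial j =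
      (2 * n + 2 + 2 * j)! := by
    have h := Nat.factorial_mul_descFactorial (show j ≤ 2 * (j + (n + 1)) by omega)
    rw [show 2 * (j + (n + 1)) - j = 2 * n + 2 + j by omega] at h
    rw [show 2 * n + 2 + 2 * j = 2 * (j + (n + 1)) by ring]
    exact_mod_cast h
  rw [← hdesc]
  have h1 := hfac j
  have h2 := hfac (2 * j)
  have h3 := hfac (n + 1 + N - j)
  have h4 := hfac (N - j)
  have h5 := hfac (2 * n + 2 + j)
  field_simp
end

section
/- For all integers n ≥ 0 and k ≥ 1, the product identity ∏_{i=0}^{n} (2i+1)!·(2k+2i)! / ((k+2i+1)!·(k+2i)!) = ∏_{i=0}^{k-1} (2n+2+2i)!·i! / ((2n+2+i)!·(2i)!) holds. -/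
open Finset Nat

/-- Increasing `m` by one multiplies `∏_{i<k} (2m+2i)!·i!/((2m+i)!·(2i)!)` by a single quotient of
factorials. -/
theorem prod_range_factorial_quotient_succ (m k : ℕ) :
    (∏ i ∈ Finset.range k,
        ((2 * m + 2 * i)! : ℚ) * (i ! : ℚ) / (((2 * m + i)! : ℚ) * ((2 * i)! : ℚ))) *
      (((2 * m + 1)! : ℚ) * ((2 * k + 2 * m)! : ℚ) /
        (((k + 2 * m + 1)! : ℚ) * ((k + 2 * m)! : ℚ))) =
    ∏ i ∈ Finset.range k,
        ((2 * m + 2 + 2 * i)! : ℚ) * (i ! : ℚ) / (((2 * m + 2 + i)! : ℚ) * ((2 * i)! : ℚ)) := by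
  induction k with
  | zero =>
    simp only [Finset.range_zero, Finset.prod_empty, mul_zero, zero_add, one_mul]
    exact div_self (by positivity)
  | succ k ih =>
    rw [Finset.prod_range_succ, Finset.prod_range_succ, ← ih, mul_assoc, mul_assoc]
    congr 1
    rw [show 2 * (k + 1) + 2 * m = 2 * m + 2 * k + 1 + 1 by ring,
      show k + 1 + 2 * m + 1 = 2 * m + k + 1 + 1 by ring,
      show k + 1 + 2 * m = 2 * m + k + 1 by ring,
      show 2 * m + 2 + 2 * k = 2 * m + 2 * k + 1 + 1 by ring,
      show 2 * m + 2 + k = 2 * m + k + 1 + 1 by ring,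
      show 2 * k + 2 * m = 2 * m + 2 * k by ring,
      show k + 2 * m + 1 = 2 * m + k + 1 by ring,
      show k + 2 * m = 2 * m + k by ring]
    have hfac (a : ℕ) : (a ! : ℚ) ≠ 0 := mod_cast Nat.factorial_ne_zero a
    field_simp [hfac]

/-- The factorial product identity between products of lengths `m` and `k`. -/
theorem prod_range_factorial_quotient_comm (m k : ℕ) :
    ∏ i ∈ Finset.range m,
        ((2 * i + 1)! : ℚ) * ((2 * k + 2 * i)! : ℚ) /
          (((k + 2 * i + 1)! : ℚ) * ((k + 2 * i)! : ℚ)) =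
      ∏ i ∈ Finset.range k,
        ((2 * m + 2 * i)! : ℚ) * (i ! : ℚ) / (((2 * m + i)! : ℚ) * ((2 * i)! : ℚ)) := by
  induction m with
  | zero =>
    simp only [Finset.range_zero, Finset.prod_empty, mul_zero, zero_add]
    refine (Finset.prod_eq_one fun i _ => ?_).symm
    rw [mul_comm]
    exact div_self (by positivity)
  | succ m ih =>
    rw [Finset.prod_range_succ, ih, prod_range_factorial_quotient_succ]
    rfl

/-- The two determinant evaluations of the half-hexagon tiling partition function agree:
`∏_{i=0}^{n} (2i+1)!·(2k+2i)!/((k+2i+1)!·(k+2i)!) = ∏_{i=0}^{k-1} (2n+2+2i)!·i!/((2n+2+i)!·(2i)!)`. -/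
theorem half_hexagon_product_identity (n k : ℕ) (hk : 1 ≤ k) :
    ∏ i ∈ Finset.range (n + 1),
        ((2 * i + 1)! : ℚ) * ((2 * k + 2 * i)! : ℚ) /
          (((k + 2 * i + 1)! : ℚ) * ((k + 2 * i)! : ℚ)) =
      ∏ i ∈ Finset.range k,
        ((2 * n + 2 + 2 * i)! : ℚ) * (i ! : ℚ) /
          (((2 * n + 2 + i)! : ℚ) * ((2 * i)! : ℚ)) :=
  prod_range_factorial_quotient_comm (n + 1) k
end

section
/- For every nonnegative integer n, the determinant of the (n+1)×(n+1) matrix with (i,j) entry C(2i+j, j), for 0 ≤ i,j ≤ n, equals 2^{n(n+1)/2}. -/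
open Finset Nat

open Polynomial in
/-- The rising factorial `(x + 1) ⋯ (x + k)` at a natural number is `k! * C(m + k, k)`. -/
theorem eval_ascPochhammer_comp_X_add_one (m k : ℕ) :
    ((ascPochhammer ℤ k).comp (X + C 1)).eval (m : ℤ) = (k ! : ℤ) * ((m + k).choose k : ℤ) := by
  have h : ((m : ℤ) + 1) = ((m + 1 : ℕ) : ℤ) := by push_cast; rfl
  rw [eval_comp, eval_add, eval_X, eval_C, h, ← ascPochhammer_eval_cast,
    ascPochhammer_nat_eq_ascFactorial, Nat.ascFactorial_eq_factorial_mul_choose]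
  push_cast
  rfl

theorem det_vandermonde_two_mul (n : ℕ) :
    (Matrix.vandermonde fun i : Fin (n + 1) => ((2 * (i : ℕ) : ℕ) : ℤ)).det =
      2 ^ (n * (n + 1) / 2) * (n.superFactorial : ℤ) := by
  have hpow : ∏ j : Fin (n + 1), (2 : ℤ) ^ (j : ℕ) = 2 ^ (n * (n + 1) / 2) := by
    rw [Fin.prod_univ_eq_prod_range (fun j => (2 : ℤ) ^ j), Finset.prod_pow_eq_pow_sum,
      Finset.sum_range_id, Nat.add_sub_cancel, Nat.mul_comm]
  rw [← Matrix.det_vandermonde_id_eq_superFactorial, ← hpow, ← Matrix.det_mul_row]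
  congr 1
  ext i j
  simp [Matrix.vandermonde_apply, mul_pow]

/-- The determinant of the (n+1)×(n+1) matrix with entries `C(2i+j, j)` equals
`2^{n(n+1)/2}`. -/
theorem path_model_det (n : ℕ) :
    Matrix.det (Matrix.of fun i j : Fin (n + 1) =>
        ((2 * (i : ℕ) + (j : ℕ)).choose (j : ℕ) : ℤ)) =
      2 ^ (n * (n + 1) / 2) := by
  have hfact : ∏ j : Fin (n + 1), (((j : ℕ)! : ℕ) : ℤ) = (n.superFactorial : ℤ) := by
    rw [Fin.prod_univ_eq_prod_range (fun j => ((j ! : ℕ) : ℤ)), ← Nat.cast_prod,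
      Nat.prod_range_succ_factorial]
  have hne : (n.superFactorial : ℤ) ≠ 0 := by
    rw [← hfact]
    exact Finset.prod_ne_zero_iff.2 fun j _ => mod_cast Nat.factorial_ne_zero j
  have hdet := Matrix.det_eval_matrixOfPolynomials_eq_det_vandermonde
    (fun i : Fin (n + 1) => ((2 * (i : ℕ) : ℕ) : ℤ))
    (fun j => (ascPochhammer ℤ (j : ℕ)).comp (Polynomial.X + Polynomial.C 1))
    (fun j => by
      rw [Polynomial.natDegree_comp, Polynomial.natDegree_X_add_C, mul_one,
        ascPochhammer_natDegree])
    (fun j => (monic_ascPochhammer ℤ (j : ℕ)).comp_X_add_C 1)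
  simp_rw [eval_ascPochhammer_comp_X_add_one] at hdet
  rw [det_vandermonde_two_mul] at hdet
  refine mul_left_cancel₀ hne ?_
  rw [mul_comm _ (2 ^ _ : ℤ), hdet, ← hfact, ← Matrix.det_mul_row]
  rfl
end

section
/- For all nonnegative integers n and ℓ with 0 ≤ ℓ ≤ 2n, one has ∑_{k=0}^{n} (-1)^{n+k}·C(n,k)·C(n+2k-ℓ, n) = ∑_{k=0}^{min(n, 2n-ℓ)} C(n,k), where C(n+2k-ℓ, n) is taken to be 0 whenever n+2k-ℓ < n (i.e. whenever 2k < ℓ). -/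
open PowerSeries in
/-- The series `(1 - X²)ⁿ / (1 - X)ⁿ⁺¹` equals `(1 + X)ⁿ / (1 - X)`. -/
theorem one_sub_sq_pow_mul_mk_add_choose (n : ℕ) :
    (1 - X ^ 2 : ℤ⟦X⟧) ^ n * (mk fun i => ((n + i).choose n : ℤ)) = (1 + X) ^ n * mk 1 := by
  have h : (mk fun i => ((n + i).choose n : ℤ)) * (1 - X) ^ (n + 1) = 1 :=
    mk_add_choose_mul_one_sub_pow_eq_one ℤ n
  have h1 : (mk 1 : ℤ⟦X⟧) * (1 - X) = 1 := mk_one_mul_one_sub_eq_one ℤ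
  have hf : (1 - X ^ 2 : ℤ⟦X⟧) ^ n = (1 + X) ^ n * (1 - X) ^ n := by
    rw [← mul_pow]
    ring
  rw [hf]
  linear_combination (-(1 + X) ^ n * (1 - X) ^ n * (mk fun i => ((n + i).choose n : ℤ))) * h1 +
    (1 + X) ^ n * mk 1 * h

open PowerSeries in
theorem coeff_one_sub_sq_pow_mul (n m : ℕ) (f : ℤ⟦X⟧) :
    coeff m ((1 - X ^ 2) ^ n * f) =
      ∑ j ∈ Finset.range (n + 1), (-1 : ℤ) ^ j * (n.choose j : ℤ) *
        (if 2 * j ≤ m then coeff (m - 2 * j) f else 0) := by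
  have hf : (1 - X ^ 2 : ℤ⟦X⟧) ^ n * f =
      ∑ j ∈ Finset.range (n + 1), C ((-1 : ℤ) ^ j * (n.choose j : ℤ)) * (X ^ (2 * j) * f) := by
    rw [sub_eq_neg_add, add_pow, Finset.sum_mul]
    refine Finset.sum_congr rfl fun j _ => ?_
    simp only [map_mul, map_pow, map_neg, map_one, map_natCast, one_pow, neg_pow (X ^ 2), pow_mul]
    ring
  simp only [hf, map_sum, coeff_C_mul, coeff_X_pow_mul']

open PowerSeries in
theorem coeff_one_add_X_pow_mul_mk_one (n m : ℕ) :
    coeff m ((1 + X : ℤ⟦X⟧) ^ n * mk 1) = ∑ k ∈ Finset.range (m + 1), (n.choose k : ℤ) := by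
  have hp (k : ℕ) : coeff k ((1 + X : ℤ⟦X⟧) ^ n) = (n.choose k : ℤ) := by
    rw [← Polynomial.coeff_one_add_X_pow ℤ n k, ← Polynomial.coeff_coe]
    simp
  simp [coeff_mul, Finset.Nat.sum_antidiagonal_eq_sum_range_succ_mk, hp]

theorem sum_range_min_choose (n m : ℕ) :
    ∑ k ∈ Finset.range (min n m + 1), (n.choose k : ℤ) =
      ∑ k ∈ Finset.range (m + 1), (n.choose k : ℤ) := by
  refine Finset.sum_subset (Finset.range_mono (by omega)) fun k hk hk' => ?_
  simp only [Finset.mem_range] at hk hk'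
  rw [Nat.choose_eq_zero_of_lt (by omega), Nat.cast_zero]

/-- For `0 ≤ ℓ ≤ 2n`,
`∑_{k=0}^{n} (-1)^{n+k}·C(n,k)·C(n+2k-ℓ, n) = ∑_{k=0}^{min(n, 2n-ℓ)} C(n,k)`,
where `C(n+2k-ℓ, n)` is taken to be `0` when `2k < ℓ`. -/
theorem square_path_one_point (n ℓ : ℕ) (hℓ : ℓ ≤ 2 * n) :
    ∑ k ∈ Finset.range (n + 1), (-1 : ℤ) ^ (n + k) * (n.choose k : ℤ) *
        (if ℓ ≤ 2 * k then ((n + 2 * k - ℓ).choose n : ℤ) else 0) =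
      ∑ k ∈ Finset.range (min n (2 * n - ℓ) + 1), (n.choose k : ℤ) := by
  rw [sum_range_min_choose, ← coeff_one_add_X_pow_mul_mk_one,
    ← one_sub_sq_pow_mul_mk_add_choose, coeff_one_sub_sq_pow_mul, ← Finset.sum_range_reflect]
  refine Finset.sum_congr rfl fun j hj => ?_
  have hjn : j ≤ n := Nat.lt_succ_iff.mp (Finset.mem_range.mp hj)
  have hsub : n + 1 - 1 - j = n - j := by omega
  have hsign : (-1 : ℤ) ^ (n + (n - j)) = (-1) ^ j :=
    neg_one_pow_congr (by grind)
  have hiff : ℓ ≤ 2 * (n - j) ↔ 2 * j ≤ 2 * n - ℓ := by omega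
  rw [hsub, hsign, Nat.choose_symm hjn, PowerSeries.coeff_mk]
  simp only [hiff]
  split_ifs with h
  · rw [show n + 2 * (n - j) - ℓ = n + (2 * n - ℓ - 2 * j) by omega]
  · rfl
end

section
/- For every nonnegative integer n, the determinant of the (n+1)×(n+1) matrix with (i,j) entry C(2i, j), for 0 ≤ i,j ≤ n, equals 2^{n(n+1)/2}. -/
open Finset Nat

open Polynomial in
/-- Expanding `(1 + X) ^ (2 * i) = (1 + X * (X + 2)) ^ i` in powers of `X * (X + 2)`. -/
theorem choose_two_mul_eq_sum {i n : ℕ} (hi : i ≤ n) (j : ℕ) :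
    ((2 * i).choose j : ℤ) =
      ∑ k ∈ range (n + 1), (i.choose k : ℤ) * ((X * (X + 2) : ℤ[X]) ^ k).coeff j := by
  have h : (1 + X : ℤ[X]) ^ (2 * i) =
      ∑ k ∈ range (i + 1), C (i.choose k : ℤ) * (X * (X + 2)) ^ k := by
    rw [pow_mul, show (1 + X : ℤ[X]) ^ 2 = X * (X + 2) + 1 by ring, add_pow]
    refine sum_congr rfl fun k _ => ?_
    simp [mul_comm]
  rw [← coeff_one_add_X_pow ℤ (2 * i) j, h, finsetSum_coeff]
  simp only [coeff_C_mul]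
  refine sum_subset (range_mono (by lia)) fun k _ hk => ?_
  rw [Nat.choose_eq_zero_of_lt (by simpa using hk), Nat.cast_zero, zero_mul]

/-- The determinant of the (n+1)×(n+1) matrix with entries `C(2i, j)` equals
`2^{n(n+1)/2}`. -/
theorem tilted_path_model_det (n : ℕ) :
    Matrix.det (Matrix.of fun i j : Fin (n + 1) =>
        ((2 * (i : ℕ)).choose (j : ℕ) : ℤ)) =
      2 ^ (n * (n + 1) / 2) := by
  let L : Matrix (Fin (n + 1)) (Fin (n + 1)) ℤ := Matrix.of fun i k => ((i : ℕ).choose k : ℤ)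
  let U : Matrix (Fin (n + 1)) (Fin (n + 1)) ℤ := Matrix.of fun k j =>
    ((Polynomial.X * (Polynomial.X + 2) : Polynomial ℤ) ^ (k : ℕ)).coeff j
  have hLU : (Matrix.of fun i j : Fin (n + 1) =>
      ((2 * (i : ℕ)).choose (j : ℕ) : ℤ)) = L * U := by
    ext i j
    simp only [L, U, Matrix.mul_apply, Matrix.of_apply]
    rw [choose_two_mul_eq_sum (Nat.lt_succ_iff.mp i.isLt) j, Finset.sum_range]
  have hL : L.det = 1 := by
    rw [Matrix.det_of_isLowerTriangular L fun i j hij => ?_]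
    · simp [L]
    · have : (i : ℕ) < j := hij
      simp [L, Nat.choose_eq_zero_of_lt this]
  have hU : U.det = ∏ k : Fin (n + 1), 2 ^ (k : ℕ) := by
    rw [Matrix.det_of_isUpperTriangular fun i j hij => ?_]
    · refine prod_congr rfl fun k _ => ?_
      simp [U, mul_pow, Polynomial.coeff_X_pow_mul', Polynomial.coeff_zero_eq_eval_zero]
    · have hij' : j < i := hij
      simp [U, mul_pow, Polynomial.coeff_X_pow_mul', not_le.mpr hij']
  rw [hLU, Matrix.det_mul, hL, hU, one_mul, Fin.prod_univ_eq_prod_range (fun k => (2 : ℤ) ^ k),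
    prod_pow_eq_pow_sum, sum_range_id, Nat.add_sub_cancel, mul_comm]
end

section
/- For all integers n ≥ 0 and a ≥ 1, the reciprocal of the binomial coefficient C(n+a, a) satisfies 1/C(n+a,a) = ∑_{m=0}^{n} (-1)^m · (a/(m+a)) · C(n,m), as an identity of rational numbers. -/
/-- Pascal's rule for alternating binomial sums. -/
theorem sum_neg_one_pow_mul_choose_succ (f : ℕ → ℚ) (n : ℕ) :
    ∑ m ∈ Finset.range (n + 2), (-1 : ℚ) ^ m * f m * ((n + 1).choose m : ℚ) =
      ∑ m ∈ Finset.range (n + 1), (-1 : ℚ) ^ m * f m * (n.choose m : ℚ) -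
        ∑ m ∈ Finset.range (n + 1), (-1 : ℚ) ^ m * f (m + 1) * (n.choose m : ℚ) := by
  have h : ∑ m ∈ Finset.range (n + 1), (-1 : ℚ) ^ m * f m * (n.choose m : ℚ) =
      ∑ m ∈ Finset.range (n + 2), (-1 : ℚ) ^ m * f m * (n.choose m : ℚ) := by
    rw [Finset.sum_range_succ _ (n + 1)]
    simp
  rw [h, Finset.sum_range_succ' _ (n + 1), Finset.sum_range_succ' _ (n + 1),
    add_sub_right_comm, ← Finset.sum_sub_distrib]
  congr 1
  · refine Finset.sum_congr rfl fun m _ => ?_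
    rw [Nat.choose_succ_succ']
    push_cast
    ring
  · simp

theorem sum_neg_one_pow_mul_inv_add_mul_choose (n a : ℕ) (ha : 1 ≤ a) :
    ∑ m ∈ Finset.range (n + 1), (-1 : ℚ) ^ m * ((m : ℚ) + a)⁻¹ * (n.choose m : ℚ) =
      ((a : ℚ) * ((n + a).choose a : ℚ))⁻¹ := by
  induction n generalizing a with
  | zero => simp
  | succ n ih =>
    rw [sum_neg_one_pow_mul_choose_succ (fun m => ((m : ℚ) + a)⁻¹), ih a ha]
    have h := ih (a + 1) (by omega)
    have e : ∀ m : ℕ, ((m + 1 : ℕ) : ℚ) + a = (m : ℚ) + ((a + 1 : ℕ) : ℚ) := by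
      intro m
      push_cast
      ring
    simp only [e, h]
    have h₁ : ((n : ℚ) + a + 1) * ((n + a).choose a : ℚ) =
        ((n + (a + 1)).choose (a + 1) : ℚ) * (a + 1) := by
      exact_mod_cast Nat.add_one_mul_choose_eq (n + a) a
    have h₂ : ((n + a).choose a : ℚ) * ((n : ℚ) + a + 1) =
        ((n + 1 + a).choose a : ℚ) * (n + 1) := by
      have h₃ := Nat.choose_mul_succ_eq (n + a) a
      rw [show n + a + 1 - a = n + 1 by omega, show n + a + 1 = n + 1 + a by omega] at h₃
      rw [show (n : ℚ) + a + 1 = n + 1 + a by ring]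
      exact_mod_cast h₃
    have hc : ((n + a).choose a : ℚ) ≠ 0 := by
      exact_mod_cast (Nat.choose_pos (Nat.le_add_left a n)).ne'
    have ha' : (a : ℚ) ≠ 0 := by
      exact_mod_cast (by omega : a ≠ 0)
    have hn : (n : ℚ) + 1 ≠ 0 := by positivity
    have hna : (n : ℚ) + a + 1 ≠ 0 := by positivity
    rw [Nat.cast_succ a, mul_comm ((a : ℚ) + 1), ← h₁, (eq_div_of_mul_eq hn h₂.symm :
      ((n + 1 + a).choose a : ℚ) = _)]
    field_simp
    ring

/-- For `n ≥ 0` and `a ≥ 1`, the reciprocal binomial coefficient satisfies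
`1/C(n+a, a) = ∑_{m=0}^{n} (-1)^m·(a/(m+a))·C(n,m)` in `ℚ`. -/
theorem inverse_binomial_sum (n a : ℕ) (ha : 1 ≤ a) :
    (1 : ℚ) / ((n + a).choose a : ℚ) =
      ∑ m ∈ Finset.range (n + 1),
        (-1 : ℚ) ^ m * ((a : ℚ) / ((m : ℚ) + a)) * (n.choose m : ℚ) := by
  have h := sum_neg_one_pow_mul_inv_add_mul_choose n a ha
  have ha' : (a : ℚ) ≠ 0 := by
    exact_mod_cast (by omega : a ≠ 0)
  calc (1 : ℚ) / ((n + a).choose a : ℚ)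
      = a * ((a : ℚ) * ((n + a).choose a : ℚ))⁻¹ := by
        rw [mul_inv, mul_inv_cancel_left₀ ha', one_div]
    _ = _ := by
        rw [← h, Finset.mul_sum]
        refine Finset.sum_congr rfl fun m _ => ?_
        ring
end

section
/- For all integers i > j ≥ 0, the alternating sum ∑_{m=j}^{min(i,2j)} (-1)^m · m · C(2i-m-1, 2i-2j-1) · C(i-j, m-j) equals 0; equivalently, ∑_{m=j}^{min(i,2j)} (-1)^m · m · (2i-m-1)! / ((2j-m)!·(i-m)!·(m-j)!) = 0. -/
open Finset Nat

/-- The `n`-th finite difference of a binomial coefficient in its upper argument. -/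
theorem sum_neg_one_pow_mul_choose_mul_choose (n a r : ℕ) :
    ∑ k ∈ range (n + 1), (-1 : ℤ) ^ k * (n.choose k : ℤ) * ((a + n - k).choose (n + r) : ℤ) =
      (a.choose r : ℤ) := by
  have h := congrFun (fwdDiff_iter_choose r n) a
  rw [fwdDiff_iter_eq_sum_shift] at h
  rw [← h, ← sum_range_reflect]
  refine sum_congr rfl fun k hk => ?_
  have hk : k ≤ n := Nat.lt_succ_iff.mp (mem_range.mp hk)
  have e : a + n - (n - k) = a + k := by omega
  simp [e, Nat.choose_symm hk]

theorem sum_neg_one_pow_mul_add_mul_choose_mul_choose (d j : ℕ) :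
    ∑ k ∈ range (d + 2), (-1 : ℤ) ^ k * ((j + k : ℕ) : ℤ) *
      ((2 * d + 1 + j - k).choose (2 * d + 1) : ℤ) * ((d + 1).choose k : ℤ) = 0 := by
  have h₁ := sum_neg_one_pow_mul_choose_mul_choose (d + 1) (d + j) d
  have h₂ := sum_neg_one_pow_mul_choose_mul_choose d (d + j) (d + 1)
  have hc : ((d + j).choose (d + 1) : ℤ) * (d + 1) = (d + j).choose d * j := by
    have := Nat.choose_succ_right_eq (d + j) d
    rw [Nat.add_sub_cancel_left] at this
    exact_mod_cast this
  have hs : ∑ k ∈ range (d + 2), (-1 : ℤ) ^ k * (k : ℤ) *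
      ((2 * d + 1 + j - k).choose (2 * d + 1) : ℤ) * ((d + 1).choose k : ℤ) =
      -(d + 1) * ((d + j).choose (d + 1) : ℤ) := by
    rw [sum_range_succ', ← h₂, mul_sum]
    simp only [Nat.cast_zero, mul_zero, zero_mul, add_zero]
    refine sum_congr rfl fun k _ => ?_
    have e : 2 * d + 1 + j - (k + 1) = d + j + d - k := by omega
    have e' : d + (d + 1) = 2 * d + 1 := by ring
    have hk : ((d : ℤ) + 1) * d.choose k = (d + 1).choose (k + 1) * (k + 1) := by
      exact_mod_cast Nat.add_one_mul_choose_eq d k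
    rw [e, e', pow_succ]
    push_cast
    linear_combination (-1 : ℤ) ^ k * ((d + j + d - k).choose (2 * d + 1) : ℤ) * hk
  have hj : ∑ k ∈ range (d + 2), (-1 : ℤ) ^ k * (j : ℤ) *
      ((2 * d + 1 + j - k).choose (2 * d + 1) : ℤ) * ((d + 1).choose k : ℤ) =
      j * ((d + j).choose d : ℤ) := by
    rw [← h₁, mul_sum]
    refine sum_congr rfl fun k _ => ?_
    have e : 2 * d + 1 + j - k = d + j + (d + 1) - k := by omega
    have e' : d + 1 + d = 2 * d + 1 := by ring
    rw [e, e']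
    ring
  have : ∀ k : ℕ, (-1 : ℤ) ^ k * ((j + k : ℕ) : ℤ) *
      ((2 * d + 1 + j - k).choose (2 * d + 1) : ℤ) * ((d + 1).choose k : ℤ) =
      (-1 : ℤ) ^ k * (j : ℤ) *
        ((2 * d + 1 + j - k).choose (2 * d + 1) : ℤ) * ((d + 1).choose k : ℤ) +
      (-1 : ℤ) ^ k * (k : ℤ) *
        ((2 * d + 1 + j - k).choose (2 * d + 1) : ℤ) * ((d + 1).choose k : ℤ) := by
    intro k
    push_cast
    ring
  simp only [this, sum_add_distrib, hs, hj]
  linear_combination -hc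

theorem sum_Icc_neg_one_pow_mul_choose_mul_choose (i j : ℕ) (h : j < i) :
    ∑ m ∈ Finset.Icc j (min i (2 * j)),
      (-1 : ℤ) ^ m * (m : ℤ) * ((2 * i - m - 1).choose (2 * i - 2 * j - 1) : ℤ) *
        ((i - j).choose (m - j) : ℤ) = 0 := by
  obtain ⟨d, rfl⟩ := Nat.exists_eq_add_of_lt h
  have hsub : Icc j (min (j + d + 1) (2 * j)) ⊆ Ico j (j + d + 2) := by
    intro m hm
    simp only [mem_Icc, mem_Ico] at hm ⊢
    omega
  rw [sum_subset hsub, sum_Ico_eq_sum_range]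
  · have e : j + d + 2 - j = d + 2 := by omega
    rw [e]
    trans (-1 : ℤ) ^ j * ∑ k ∈ range (d + 2), (-1 : ℤ) ^ k * ((j + k : ℕ) : ℤ) *
      ((2 * d + 1 + j - k).choose (2 * d + 1) : ℤ) * ((d + 1).choose k : ℤ)
    · rw [mul_sum]
      refine sum_congr rfl fun k _ => ?_
      have e₁ : 2 * (j + d + 1) - (j + k) - 1 = 2 * d + 1 + j - k := by omega
      have e₂ : 2 * (j + d + 1) - 2 * j - 1 = 2 * d + 1 := by omega
      have e₃ : j + d + 1 - j = d + 1 := by omega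
      rw [e₁, e₂, e₃, Nat.add_sub_cancel_left, pow_add]
      ring
    · rw [sum_neg_one_pow_mul_add_mul_choose_mul_choose, mul_zero]
  · intro m hm hm'
    simp only [mem_Icc, mem_Ico] at hm hm'
    rw [Nat.choose_eq_zero_of_lt (by omega : 2 * (j + d + 1) - m - 1 < _)]
    simp

/-- For `i > j ≥ 0`, the alternating sum
`∑_{m=j}^{min(i,2j)} (-1)^m·m·C(2i-m-1, 2i-2j-1)·C(i-j, m-j)` vanishes;
equivalently, `∑_{m=j}^{min(i,2j)} (-1)^m·m·(2i-m-1)!/((2j-m)!·(i-m)!·(m-j)!) = 0`. -/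
theorem mutually_inverse_sum (i j : ℕ) (h : j < i) :
    (∑ m ∈ Finset.Icc j (min i (2 * j)),
        (-1 : ℤ) ^ m * (m : ℤ) * ((2 * i - m - 1).choose (2 * i - 2 * j - 1) : ℤ) *
          ((i - j).choose (m - j) : ℤ) = 0) ∧
      (∑ m ∈ Finset.Icc j (min i (2 * j)),
          (-1 : ℚ) ^ m * (m : ℚ) * ((2 * i - m - 1)! : ℚ) /
            (((2 * j - m)! : ℚ) * ((i - m)! : ℚ) * ((m - j)! : ℚ)) = 0) := by
  have hz := sum_Icc_neg_one_pow_mul_choose_mul_choose i j h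
  refine ⟨hz, ?_⟩
  have hq := congrArg (Int.cast : ℤ → ℚ) hz
  push_cast at hq
  rw [← mul_zero (((2 * i - 2 * j - 1)! : ℚ) / ((i - j)! : ℚ)), ← hq, mul_sum]
  refine sum_congr rfl fun m hm => ?_
  simp only [mem_Icc, le_min_iff] at hm
  rw [Nat.cast_choose ℚ (by omega : 2 * i - 2 * j - 1 ≤ 2 * i - m - 1),
    Nat.cast_choose ℚ (by omega : m - j ≤ i - j)]
  have e₁ : 2 * i - m - 1 - (2 * i - 2 * j - 1) = 2 * j - m := by omega
  have e₂ : i - j - (m - j) = i - m := by omega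
  rw [e₁, e₂]
  have hf (n : ℕ) : (n ! : ℚ) ≠ 0 := Nat.cast_ne_zero.mpr n.factorial_ne_zero
  have := hf (2 * i - 2 * j - 1)
  have := hf (i - j)
  have := hf (2 * j - m)
  have := hf (i - m)
  have := hf (m - j)
  field_simp
end
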